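/- Let α∈(0,1) and θ∈ℝ with α+θ>0, and let (K_n,(K_{r,n})_{r≥1}) be the Ewens–Pitman block-counting chain with parameters (α,θ). Then for every integer r≥1, the random variable √(K_n)·(∑_{i=1}^r b_{r,i}P_{i,n} + (−1)^r p_α(r)) converges in distribution, as n→∞, to a centered Gaussian distribution with variance p_α(r)·(r−α)^{(r)}/r!. In particular, for r=1 this gives that √(K_n)(P_{1,n}−α) converges in distribution to a centered Gaussian distribution with variance α(1−α). -/

import Mathlib

open MeasureTheory ProbabilityTheory Filter Topology

noncomputable section

/-- Rising factorial `(a)^(m) = a (a+1) ⋯ (a+m-1)` of a real number. -/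
def risingFactorial (a : ℝ) : ℕ → ℝ
  | 0 => 1
  | m + 1 => risingFactorial a m * (a + m)

/-- Sibuya probabilities `p_α(r) = α (1-α)^(r-1) / r!` for `r ≥ 1`. -/
def sibuya (α : ℝ) (r : ℕ) : ℝ :=
  α * risingFactorial (1 - α) (r - 1) / (Nat.factorial r : ℝ)

/-- The Ewens–Pitman block-counting chain with parameters `(α, θ)` on a probability space
`(Ω, μ)` with filtration `F`: for `n ≥ 1`, `K n` is the number of blocks and `B r n` the
number of blocks of size `r` of the Ewens–Pitman random partition of `{1,…,n}`.
It starts from `K 1 = 1`, `B 1 1 = 1`, `B r 1 = 0` for `r ≥ 2`, and the transition from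
time `n` to `n+1` creates a new block with conditional probability `(α K n + θ)/(n + θ)`,
and grows a block of size `r` to size `r+1` with conditional probability
`(r - α) B r n / (n + θ)`. -/
structure IsEwensPitman (α θ : ℝ) {Ω : Type*} {mΩ : MeasurableSpace Ω}
    (μ : Measure Ω) (F : Filtration ℕ mΩ) (K : ℕ → Ω → ℕ) (B : ℕ → ℕ → Ω → ℕ) :
    Prop where
  prob : IsProbabilityMeasure μ
  meas_K : ∀ n, Measurable[F n] (K n)
  meas_B : ∀ r n, Measurable[F n] (B r n)
  init_K : ∀ᵐ ω ∂μ, K 1 ω = 1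
  init_B1 : ∀ᵐ ω ∂μ, B 1 1 ω = 1
  init_B : ∀ r, 2 ≤ r → ∀ᵐ ω ∂μ, B r 1 ω = 0
  B_eq_zero : ∀ r n, n < r → ∀ᵐ ω ∂μ, B r n ω = 0
  sum_blocks : ∀ n, 1 ≤ n → ∀ᵐ ω ∂μ, K n ω = ∑ r ∈ Finset.Icc 1 n, B r n ω
  sum_sizes : ∀ n, 1 ≤ n → ∀ᵐ ω ∂μ, n = ∑ r ∈ Finset.Icc 1 n, r * B r n ω
  trans_new : ∀ n, 1 ≤ n →
    μ[Set.indicator {ω | K (n+1) ω = K n ω + 1 ∧ B 1 (n+1) ω = B 1 n ω + 1 ∧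
        ∀ s, 2 ≤ s → B s (n+1) ω = B s n ω} (fun _ => (1:ℝ)) | F n]
      =ᵐ[μ] fun ω => (α * (K n ω : ℝ) + θ) / ((n : ℝ) + θ)
  trans_grow : ∀ n, 1 ≤ n → ∀ r, 1 ≤ r →
    μ[Set.indicator {ω | K (n+1) ω = K n ω ∧ B r (n+1) ω + 1 = B r n ω ∧
        B (r+1) (n+1) ω = B (r+1) n ω + 1 ∧
        ∀ s, 1 ≤ s → s ≠ r → s ≠ r + 1 → B s (n+1) ω = B s n ω} (fun _ => (1:ℝ)) | F n]
      =ᵐ[μ] fun ω => (((r : ℝ) - α) * (B r n ω : ℝ)) / ((n : ℝ) + θ)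

/-- The coefficients `b_{r,i} = (-1)^(r-i) (i-α)^(r-i) / (r-i)!` for `1 ≤ i ≤ r`. -/
def bCoef (α : ℝ) (r i : ℕ) : ℝ :=
  (-1 : ℝ) ^ (r - i) * risingFactorial ((i : ℝ) - α) (r - i) / (Nat.factorial (r - i) : ℝ)

section

lemma rf_left (a : ℝ) (m : ℕ) : risingFactorial a (m+1) = a * risingFactorial (a+1) m := by
  induction m with
  | zero => simp [risingFactorial]
  | succ k ih =>
    rw [risingFactorial, ih, risingFactorial]; push_cast; ring

lemma rf_add (a : ℝ) (m k : ℕ) :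
    risingFactorial a (m+k) = risingFactorial a m * risingFactorial (a+m) k := by
  induction k with
  | zero => simp [risingFactorial]
  | succ k ih =>
    rw [← add_assoc, risingFactorial, ih, risingFactorial]; push_cast; ring

lemma rf_pos {a : ℝ} (ha : 0 < a) (m : ℕ) : 0 < risingFactorial a m := by
  induction m with
  | zero => simp [risingFactorial]
  | succ k ih => rw [risingFactorial]; positivity

lemma rf_eq_eval (a : ℝ) (m : ℕ) : risingFactorial a m = (ascPochhammer ℝ m).eval a := by
  induction m with
  | zero => simp [risingFactorial]
  | succ k ih => rw [risingFactorial, ih, ascPochhammer_succ_eval]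

lemma rf_choose (a : ℝ) (m : ℕ) :
    risingFactorial (a + 1 - m) m / (m.factorial : ℝ) = Ring.choose a m := by
  have h := Ring.descPochhammer_eq_factorial_smul_choose a m
  have h2 : risingFactorial (a + 1 - m) m = m.factorial * Ring.choose a m := by
    rw [nsmul_eq_mul] at h
    rw [← h, rf_eq_eval, Polynomial.descPochhammer_smeval_eq_ascPochhammer,
      Polynomial.ascPochhammer_smeval_eq_eval]
    congr 1; ring
  rw [h2]; field_simp

/-- jump coefficients -/
def cc (α : ℝ) (r i : ℕ) : ℝ :=
  -((-1 : ℝ) ^ (r - i) * risingFactorial ((i : ℝ) + 1 - α) (r - i) / (Nat.factorial (r - i) : ℝ))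

lemma bCoef_self (α : ℝ) (r : ℕ) : bCoef α r r = 1 := by simp [bCoef, risingFactorial]

lemma cc_self (α : ℝ) (r : ℕ) : cc α r r = -1 := by simp [cc, risingFactorial]

lemma bCoef_sub (α : ℝ) (r i : ℕ) (h : i < r) :
    bCoef α r (i+1) - bCoef α r i = cc α r i := by
  obtain ⟨k, rfl⟩ := Nat.exists_eq_add_of_lt h
  simp only [bCoef, cc, show i + k + 1 - (i+1) = k by omega, show i + k + 1 - i = k+1 by omega]
  rw [rf_left, risingFactorial, Nat.factorial_succ]
  push_cast
  rw [show (i:ℝ) - α + 1 = i + 1 - α by ring]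
  field_simp
  ring

lemma cc_eigen (α : ℝ) (r i : ℕ) (h : i ≤ r) :
    ((i:ℝ) - α) * cc α r i = -((r:ℝ) - α) * bCoef α r i := by
  obtain ⟨k, rfl⟩ := Nat.exists_eq_add_of_le h
  simp only [bCoef, cc, Nat.add_sub_cancel_left]
  have := rf_left ((i:ℝ) - α) k
  rw [risingFactorial, show (i:ℝ) - α + 1 = i + 1 - α by ring] at this
  push_cast
  have e : ((i:ℝ) - α) * -((-1) ^ k * risingFactorial (↑i + 1 - α) k / (k.factorial:ℝ))
    = -((-1) ^ k * (((i:ℝ) - α) * risingFactorial (↑i + 1 - α) k) / (k.factorial:ℝ)) := by ring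
  rw [e, ← this]; ring

lemma sibuya_eq (α : ℝ) (r : ℕ) (h : 1 ≤ r) :
    sibuya α r = - risingFactorial (-α) r / (r.factorial : ℝ) := by
  obtain ⟨k, rfl⟩ := Nat.exists_eq_add_of_le' h
  rw [sibuya, rf_left, Nat.add_sub_cancel, show -α + 1 = 1 - α by ring]; ring

lemma bCoef_zero (α : ℝ) (r : ℕ) (h : 1 ≤ r) :
    bCoef α r 0 = -((-1) ^ r * sibuya α r) := by
  rw [sibuya_eq α r h]; simp [bCoef]; ring

lemma sum_bCoef_sibuya (α : ℝ) (r : ℕ) (h : 1 ≤ r) :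
    ∑ i ∈ Finset.Icc 1 r, bCoef α r i * sibuya α i = bCoef α r 0 := by
  have key : ∑ i ∈ Finset.range (r+1), bCoef α r i * (- risingFactorial (-α) i / (i.factorial : ℝ))
      = 0 := by
    have : ∀ i ∈ Finset.range (r+1), bCoef α r i * (- risingFactorial (-α) i / (i.factorial : ℝ))
        = (-(risingFactorial (-α) r) / (r.factorial : ℝ)) *
          ((1:ℝ)^i * (-1) ^ (r - i) * (r.choose i : ℝ)) := by
      intro i hi
      have hi : i ≤ r := by simpa [Nat.lt_succ_iff] using hi
      obtain ⟨k, rfl⟩ := Nat.exists_eq_add_of_le hi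
      rw [Nat.cast_add_choose, rf_add, bCoef, Nat.add_sub_cancel_left,
        show -α + (i:ℝ) = i - α by ring]
      rw [one_pow]
      field_simp
    rw [Finset.sum_congr rfl this, ← Finset.mul_sum, ← add_pow]
    simp [show r ≠ 0 by omega]
  rw [Finset.range_eq_Ico, Finset.sum_eq_sum_Ico_succ_bot (by omega)] at key
  have h2 : ∑ i ∈ Finset.Icc 1 r, bCoef α r i * sibuya α i
    = ∑ i ∈ Finset.Ico (0+1) (r+1), bCoef α r i * (- risingFactorial (-α) i / (i.factorial : ℝ)) := by
    apply Finset.sum_congr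
    · ext; simp [Nat.succ_le_iff]
    · intro i hi
      rw [sibuya_eq]; simp at hi; omega
  rw [h2]
  simp [risingFactorial] at key ⊢
  linarith

lemma variance_identity (α : ℝ) (r : ℕ) (h : 1 ≤ r) :
    α * cc α r 0 ^ 2 + ∑ i ∈ Finset.Icc 1 r, ((i:ℝ) - α) * sibuya α i * cc α r i ^ 2
      = (2 * r - α) * (sibuya α r * (risingFactorial ((r : ℝ) - α) r / (Nat.factorial r : ℝ))) := by
  have h2 : α * cc α r 0 ^ 2 + ∑ i ∈ Finset.Icc 1 r, ((i:ℝ) - α) * sibuya α i * cc α r i ^ 2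
    = ∑ i ∈ Finset.range (r+1),
      ((i:ℝ) - α) * (- risingFactorial (-α) i / (i.factorial : ℝ)) * cc α r i ^ 2 := by
    rw [Finset.range_eq_Ico, Finset.sum_eq_sum_Ico_succ_bot (by omega)]
    congr 1
    · simp [risingFactorial]
    · apply Finset.sum_congr
      · ext; simp [Nat.succ_le_iff]
      · intro i hi
        rw [sibuya_eq]; simp at hi; omega
  have h3 : ∀ i ∈ Finset.range (r+1),
      ((i:ℝ) - α) * (- risingFactorial (-α) i / (i.factorial : ℝ)) * cc α r i ^ 2
      = α * risingFactorial (1-α) r / (r.factorial : ℝ) *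
        (Ring.choose (r:ℝ) i * Ring.choose ((r:ℝ) - α) (r - i)) := by
    intro i hi
    have hi : i ≤ r := by simpa [Nat.lt_succ_iff] using hi
    obtain ⟨k, rfl⟩ := Nat.exists_eq_add_of_le hi
    have e1 := rf_left (-α) i
    rw [risingFactorial, show -α + 1 = 1 - α by ring] at e1
    have e2 := rf_add (1-α) i k
    rw [Ring.choose_natCast, Nat.cast_add_choose,
      Nat.add_sub_cancel_left, ← rf_choose, e2, cc, Nat.add_sub_cancel_left]
    push_cast
    rw [show (i:ℝ) + k - α + 1 - k = i + 1 - α by ring, show 1 - α + (i:ℝ) = i + 1 - α by ring]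
    have e3 : ((i:ℝ) - α) * (- risingFactorial (-α) i / (i.factorial : ℝ)) =
      α * risingFactorial (1-α) i / (i.factorial : ℝ) := by
      have : ((i:ℝ) - α) * (- risingFactorial (-α) i / (i.factorial : ℝ)) =
        -(risingFactorial (-α) i * (-α + i)) / (i.factorial : ℝ) := by ring
      rw [this, e1]; ring
    rw [e3]
    have : ((-1:ℝ)^k)^2 = 1 := by rw [← pow_mul, mul_comm, pow_mul]; simp
    rw [neg_sq, div_pow, mul_pow, this]
    field_simp
  rw [h2, Finset.sum_congr rfl h3, ← Finset.mul_sum]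
  have v := Ring.add_choose_eq (r := (r:ℝ)) (s := (r:ℝ) - α) r (Commute.all _ _)
  rw [Finset.Nat.sum_antidiagonal_eq_sum_range_succ_mk] at v
  rw [← v, ← rf_choose, sibuya]
  obtain ⟨k, rfl⟩ := Nat.exists_eq_add_of_le' h
  have e4 := rf_left ((k+1 : ℕ) - α : ℝ) (k+1)
  rw [risingFactorial] at e4
  rw [show ((k+1:ℕ):ℝ) + ((k+1:ℕ) - α) + 1 - (k+1:ℕ) = (k+1:ℕ) - α + 1 by ring]
  rw [Nat.add_sub_cancel, risingFactorial]
  push_cast at e4 ⊢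
  have : (1 - α + k) * risingFactorial ((k:ℝ) + 1 - α + 1) (k+1) =
     risingFactorial ((k:ℝ) + 1 - α) (k+1) * (2 * (k+1) - α) := by
    rw [show 1 - α + (k:ℝ) = k + 1 - α by ring, ← e4]; ring
  field_simp
  linear_combination α * risingFactorial (1-α) k * this

end

section

lemma rec_tendsto (θ : ℝ) (hθ : -1 < θ) (a : ℝ) (ha : 0 < a) (x ε : ℕ → ℝ) (N : ℕ)
    (hx0 : ∀ n, N ≤ n → 0 ≤ x n) (hε : Tendsto ε atTop (𝓝 0))
    (h : ∀ n, N ≤ n → x (n+1) ≤ (1 - a / (n + θ)) * x n + ε n / (n + θ)) :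
    Tendsto x atTop (𝓝 0) := by
  rw [Metric.tendsto_atTop]
  intro η' hη'
  set η := η' / 2 with hη
  have hηp : 0 < η := by positivity
  obtain ⟨N1, hN1⟩ := (hε.eventually (gt_mem_nhds (show (0:ℝ) < a * η by positivity))).exists_forall_of_atTop
  obtain ⟨N2, hN2⟩ := exists_nat_gt (a - θ)
  set M := max (max N N1) (max N2 1) with hM
  set y : ℕ → ℝ := fun n => max (x n - η) 0 with hy
  have hpos : ∀ n : ℕ, 1 ≤ n → 0 < (n:ℝ) + θ := by
    intro n hn
    have : (1:ℝ) ≤ n := by exact_mod_cast hn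
    linarith
  have hyrec : ∀ n, M ≤ n → y (n+1) ≤ Real.exp (-(a / (n + θ))) * y n := by
    intro n hn
    have h1 : N ≤ n := by omega
    have h2 : N1 ≤ n := by omega
    have h3 : N2 ≤ n := by omega
    have h4 : 1 ≤ n := by omega
    have hp := hpos n h4
    have hs : a / (n + θ) ≤ 1 := by
      rw [div_le_one hp]
      have : (N2:ℝ) ≤ n := by exact_mod_cast h3
      linarith
    have e1 := h n h1
    have e2 : ε n / (n + θ) ≤ a * η / (n + θ) := by
      have := hN1 n h2
      gcongr
    have e3 : x (n+1) - η ≤ (1 - a / (n + θ)) * (x n - η) := by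
      have : a * η / (n + θ) = a / (n+θ) * η := by ring
      rw [this] at e2
      nlinarith
    have e4 : (1 - a / (n + θ)) ≤ Real.exp (-(a / (n + θ))) := by
      have := Real.add_one_le_exp (-(a / (n + θ)))
      linarith
    have e5 : 0 ≤ y n := le_max_right _ _
    apply max_le
    · calc x (n+1) - η ≤ (1 - a / (n + θ)) * (x n - η) := e3
        _ ≤ (1 - a / (n + θ)) * y n := by
          apply mul_le_mul_of_nonneg_left (le_max_left _ _); linarith
        _ ≤ _ := mul_le_mul_of_nonneg_right e4 e5
    · positivity
  set C := 1 + |θ| with hC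
  have hCp : 0 < C := by positivity
  have hy2 : ∀ m, y (M + m) ≤ Real.exp (-(a / C * ∑ i ∈ Finset.range m, 1 / ((M:ℝ) + i + 1))) * y M := by
    intro m
    induction m with
    | zero => simp
    | succ m ih =>
      have e := hyrec (M+m) (by omega)
      rw [← add_assoc]
      refine e.trans ?_
      have e6 : a / C * (1 / ((M:ℝ) + m + 1)) ≤ a / (((M + m : ℕ):ℝ) + θ) := by
        rw [div_mul_div_comm, mul_one]
        apply div_le_div_of_nonneg_left ha.le (hpos _ (by omega))
        push_cast
        have := le_abs_self θ
        have := abs_nonneg θ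
        have h5 : (0:ℝ) ≤ (M:ℝ) + m := by positivity
        nlinarith [mul_nonneg this h5]
      calc _ ≤ Real.exp (-(a / C * (1 / ((M:ℝ) + m + 1)))) *
            (Real.exp (-(a / C * ∑ i ∈ Finset.range m, 1 / ((M:ℝ) + i + 1))) * y M) := by
            apply mul_le_mul (Real.exp_le_exp.2 (by linarith)) ih (le_max_right _ _) (by positivity)
        _ = _ := by
            rw [← mul_assoc, ← Real.exp_add, Finset.sum_range_succ]; congr 2; ring
  have hdiv : Tendsto (fun m => ∑ i ∈ Finset.range m, 1 / ((M:ℝ) + i + 1)) atTop atTop := by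
    have h1 := Real.tendsto_sum_range_one_div_nat_succ_atTop
    have h2 := (tendsto_add_atTop_iff_nat M).2 h1
    have h3 := tendsto_atTop_add_const_right _ (-(∑ i ∈ Finset.range M, 1 / ((i:ℝ) + 1))) h2
    refine h3.congr ?_
    intro m
    rw [add_comm m M, Finset.sum_range_add]
    push_cast
    ring
  have hlim : Tendsto (fun m => Real.exp (-(a / C * ∑ i ∈ Finset.range m, 1 / ((M:ℝ) + i + 1))) * y M)
      atTop (𝓝 (0 * y M)) := by
    apply Tendsto.mul_const
    apply Real.tendsto_exp_atBot.comp
    apply tendsto_neg_atTop_atBot.comp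
    exact hdiv.const_mul_atTop (by positivity)
  rw [zero_mul] at hlim
  obtain ⟨m0, hm0⟩ := (hlim.eventually (gt_mem_nhds hηp)).exists_forall_of_atTop
  refine ⟨M + m0, fun n hn => ?_⟩
  obtain ⟨m, rfl⟩ := Nat.exists_eq_add_of_le (show M ≤ n by omega)
  have e7 := (hy2 m).trans_lt (hm0 m (by omega))
  have e8 : x (M+m) - η ≤ y (M+m) := le_max_left _ _
  rw [Real.dist_eq, sub_zero, abs_of_nonneg (hx0 _ (by omega))]
  linarith

lemma rec_bdd (θ : ℝ) (_hθ : -1 < θ) (a C : ℝ) (ha : 0 < a) (x : ℕ → ℝ) (N : ℕ)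
    (h : ∀ n, N ≤ n → x (n+1) ≤ (1 - a / (n + θ)) * x n + C / (n + θ)) :
    ∃ M N' : ℕ, ∀ n, N' ≤ n → x n ≤ M := by
  obtain ⟨N2, hN2⟩ := exists_nat_gt (a - θ)
  set N' := max (max N N2) 1 with hN'
  obtain ⟨M, hM⟩ := exists_nat_gt (max (x N') (C / a))
  refine ⟨M, N', fun n hn => ?_⟩
  induction n, hn using Nat.le_induction with
  | base => exact (le_max_left _ _).trans hM.le
  | succ n hn ih =>
    have h1 : N ≤ n := by omega
    have h3 : (N2:ℝ) ≤ n := by exact_mod_cast (show N2 ≤ n by omega)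
    have h4 : (1:ℝ) ≤ n := by exact_mod_cast (show 1 ≤ n by omega)
    have hp : 0 < (n:ℝ) + θ := by linarith
    have hs : a / (n + θ) ≤ 1 := by rw [div_le_one hp]; linarith
    have h5 : C ≤ a * M := by
      have := (le_max_right (x N') (C / a)).trans hM.le
      rw [div_le_iff₀ ha] at this; linarith
    have h6 : C / (n + θ) ≤ a / (n + θ) * M := by
      rw [div_mul_eq_mul_div]; gcongr
    have := h n h1
    nlinarith

lemma mv_bound (f f' : ℝ → ℂ) (h : ∀ x, HasDerivAt f (f' x) x) (h0 : f 0 = 0) (x C : ℝ)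
    (hC : ∀ y, |y| ≤ |x| → ‖f' y‖ ≤ C) : ‖f x‖ ≤ C * |x| := by
  have := Convex.norm_image_sub_le_of_norm_hasDerivWithin_le (f := f) (f' := f') (C := C)
    (s := Set.Icc (-|x|) |x|) (x := 0) (y := x) (fun y _ => (h y).hasDerivWithinAt)
    (fun y hy => hC y (abs_le.2 hy)) (convex_Icc _ _)
    (by simp) (by exact abs_le.1 le_rfl)
  simpa [h0] using this

lemma hd_exp (x : ℝ) : HasDerivAt (fun x : ℝ => Complex.exp (Complex.I * x))
    (Complex.I * Complex.exp (Complex.I * x)) x := by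
  have h1 : HasDerivAt (fun x : ℝ => Complex.I * (x:ℂ)) (Complex.I) x := by
    simpa using (Complex.ofRealCLM.hasDerivAt (x := x)).const_mul Complex.I
  simpa [mul_comm] using h1.cexp

lemma hd_ofReal (x : ℝ) : HasDerivAt (fun x : ℝ => (x:ℂ)) 1 x := by
  simpa using (hasDerivAt_id x).ofReal_comp

lemma exp_bound1 (x : ℝ) : ‖Complex.exp (Complex.I * x) - 1‖ ≤ |x| := by
  have := mv_bound (fun x : ℝ => Complex.exp (Complex.I * x) - 1)
    (fun x => Complex.I * Complex.exp (Complex.I * x)) (fun x => (hd_exp x).sub_const 1)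
    (by simp) x 1 (fun y _ => by simp [mul_comm Complex.I, Complex.norm_exp_ofReal_mul_I])
  simpa using this

lemma exp_bound2 (x : ℝ) : ‖Complex.exp (Complex.I * x) - 1 - Complex.I * x‖ ≤ x ^ 2 := by
  have := mv_bound (fun x : ℝ => Complex.exp (Complex.I * x) - 1 - Complex.I * x)
    (fun x => Complex.I * (Complex.exp (Complex.I * x) - 1))
    (fun x => by
      refine (((hd_exp x).sub_const 1).sub ((hd_ofReal x).const_mul Complex.I)).congr_deriv ?_
      ring)
    (by simp) x |x| (fun y hy => by simpa using (exp_bound1 y).trans hy)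
  rwa [← sq, sq_abs] at this

lemma exp_bound3 (x : ℝ) :
    ‖Complex.exp (Complex.I * x) - 1 - Complex.I * x + x ^ 2 / 2‖ ≤ |x| ^ 3 := by
  have := mv_bound (fun x : ℝ => Complex.exp (Complex.I * x) - 1 - Complex.I * x + (x:ℂ) ^ 2 / 2)
    (fun x => Complex.I * (Complex.exp (Complex.I * x) - 1 - Complex.I * x))
    (fun x => by
      refine ((((hd_exp x).sub_const 1).sub ((hd_ofReal x).const_mul Complex.I)).add
        (((hd_ofReal x).pow 2).div_const 2)).congr_deriv ?_
      simp only [mul_sub, ← mul_assoc, Complex.I_mul_I]; push_cast; ring)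
    (by simp) x (|x|^2) (fun y hy => by
      have h1 := exp_bound2 y
      have h2 : y ^ 2 ≤ |x| ^ 2 := by rw [← sq_abs y]; gcongr
      rw [norm_mul, Complex.norm_I, one_mul]; exact h1.trans h2)
  rwa [← pow_succ] at this

end

section

lemma u_bounds (k k1 : ℝ) (hk : 1 ≤ k) (hk1 : 0 < k1) (h : k1 ^ 2 = k ^ 2 + 1) :
    0 ≤ 1 / k - 1 / k1 ∧ 1 / k - 1 / k1 ≤ 1 / (2 * k ^ 3) ∧
      |k ^ 2 * (1 / k - 1 / k1) - 1 / (2 * k)| ≤ 1 / k ^ 3 := by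
  have hk0 : 0 < k := by linarith
  have hlt : k < k1 := by nlinarith
  have e : 1 / k - 1 / k1 = 1 / (k * k1 * (k + k1)) := by
    field_simp
    linear_combination h
  have h2 : k ^ 2 * (1 / k - 1 / k1) - 1 / (2 * k) = -(k / (k + k1) + 1) / (2 * k * k1 * (k + k1)) := by
    rw [e]; field_simp
    linear_combination (-(2 * k + k1)) * h
  refine ⟨?_, ?_, ?_⟩
  · rw [e]; positivity
  · rw [e]
    apply one_div_le_one_div_of_le (by positivity)
    nlinarith [mul_pos hk0 hk0, mul_pos hk0 hk1, mul_pos hk0 (sub_pos.2 hlt),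
      mul_pos (mul_pos hk0 hk0) (sub_pos.2 hlt)]
  · rw [h2, abs_div, abs_neg, abs_of_pos (show 0 < k / (k + k1) + 1 by positivity),
      abs_of_pos (show 0 < 2 * k * k1 * (k + k1) by positivity)]
    have h3 : k / (k + k1) ≤ 1 := by rw [div_le_one (by positivity)]; linarith
    apply div_le_div₀ (by norm_num) _ (by positivity) _ |>.trans (b := 2 / (2 * k ^ 3))
    · apply le_of_eq; field_simp
    · linarith
    · nlinarith [mul_pos hk0 hk0, mul_pos hk0 hk1, mul_pos hk0 (sub_pos.2 hlt),
        mul_pos (mul_pos hk0 hk0) (sub_pos.2 hlt), mul_pos hk0 (mul_pos hk1 hk1)]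

lemma Qb (α θ k : ℝ) (hα : 0 ≤ α) (hk : 1 ≤ k) : |α * k ^ 2 + θ| ≤ (α + |θ|) * k ^ 2 := by
  have h1 := abs_add_le (α * k ^ 2) θ
  rw [abs_of_nonneg (show 0 ≤ α * k ^ 2 by positivity)] at h1
  have h2 : |θ| * 1 ≤ |θ| * k ^ 2 := mul_le_mul_of_nonneg_left (one_le_pow₀ hk) (abs_nonneg _)
  linarith

lemma L0 (C0 c0 k T u : ℝ) (hk : 1 ≤ k) (hC0 : 0 ≤ C0) (hT : |T| ≤ C0 * k ^ 2) (hu0 : 0 ≤ u)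
    (hu1 : u ≤ 1 / (2 * k ^ 3)) : |(T + c0) * u| ≤ (C0 + |c0|) / k := by
  have hk0 : 0 < k := by linarith
  have h1 : |T + c0| ≤ (C0 + |c0|) * k ^ 2 := by
    have := abs_add_le T c0
    have h2 : |c0| * 1 ≤ |c0| * k ^ 2 := mul_le_mul_of_nonneg_left (one_le_pow₀ hk) (abs_nonneg _)
    linarith
  rw [abs_mul, abs_of_nonneg hu0]
  calc _ ≤ ((C0 + |c0|) * k ^ 2) * (1 / (2 * k ^ 3)) := by gcongr
    _ = (C0 + |c0|) / k / 2 := by field_simp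
    _ ≤ _ := half_le_self (by positivity)

lemma L1 (α θ ρ C0 c0 : ℝ) (hα : 0 ≤ α) (hC0 : 0 ≤ C0) (k T u S1 : ℝ) (hk : 1 ≤ k)
    (hT : |T| ≤ C0 * k ^ 2) (hu0 : 0 ≤ u) (hu1 : u ≤ 1 / (2 * k ^ 3))
    (hu2 : |k ^ 2 * u - 1 / (2 * k)| ≤ 1 / k ^ 3)
    (hd : (α * k ^ 2 + θ) * c0 + S1 = -ρ * T + θ * c0) :
    |(α * k ^ 2 + θ) * (c0 / k - (T + c0) * u) + S1 / k + (ρ + α / 2) * (T / k)| ≤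
      (|θ| * |c0| + α * C0 + α * |c0| + |θ| * (C0 + |c0|)) / k := by
  have hk0 : 0 < k := by linarith
  have e : (α * k ^ 2 + θ) * (c0 / k - (T + c0) * u) + S1 / k + (ρ + α / 2) * (T / k) =
      θ * c0 / k - α * (T * (k ^ 2 * u - 1 / (2 * k))) - α * (c0 * (k ^ 2 * u))
        - θ * ((T + c0) * u) := by
    have : S1 = -ρ * T + θ * c0 - (α * k ^ 2 + θ) * c0 := by linarith
    rw [this]; field_simp; ring
  have b1 : |θ * c0 / k| = |θ| * |c0| / k := by rw [abs_div, abs_mul, abs_of_pos hk0]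
  have b2 : |T * (k ^ 2 * u - 1 / (2 * k))| ≤ C0 / k := by
    rw [abs_mul]
    calc _ ≤ (C0 * k ^ 2) * (1 / k ^ 3) := by gcongr
      _ = _ := by field_simp
  have b3 : |c0 * (k ^ 2 * u)| ≤ |c0| / k := by
    rw [abs_mul, abs_of_nonneg (show 0 ≤ k ^ 2 * u by positivity)]
    calc _ ≤ |c0| * (k ^ 2 * (1 / (2 * k ^ 3))) := by gcongr
      _ = |c0| / k / 2 := by field_simp
      _ ≤ _ := half_le_self (by positivity)
  have b4 := L0 C0 c0 k T u hk hC0 hT hu0 hu1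
  rw [e]
  have t1 := abs_sub (θ * c0 / k - α * (T * (k ^ 2 * u - 1 / (2 * k))) - α * (c0 * (k ^ 2 * u)))
    (θ * ((T + c0) * u))
  have t2 := abs_sub (θ * c0 / k - α * (T * (k ^ 2 * u - 1 / (2 * k)))) (α * (c0 * (k ^ 2 * u)))
  have t3 := abs_sub (θ * c0 / k) (α * (T * (k ^ 2 * u - 1 / (2 * k))))
  rw [abs_mul α, abs_of_nonneg hα] at t2 t3
  rw [abs_mul θ] at t1
  have m1 := mul_le_mul_of_nonneg_left b2 hα
  have m2 := mul_le_mul_of_nonneg_left b3 hα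
  have m3 := mul_le_mul_of_nonneg_left b4 (abs_nonneg θ)
  have : (|θ| * |c0| + α * C0 + α * |c0| + |θ| * (C0 + |c0|)) / k =
    |θ| * |c0| / k + α * (C0 / k) + α * (|c0| / k) + |θ| * ((C0 + |c0|) / k) := by ring
  rw [this]; linarith

lemma L2 (α θ C0 c0 : ℝ) (hα : 0 ≤ α) (hC0 : 0 ≤ C0) (k T u : ℝ) (hk : 1 ≤ k)
    (hT : |T| ≤ C0 * k ^ 2) (hu0 : 0 ≤ u) (hu1 : u ≤ 1 / (2 * k ^ 3)) :
    |(α * k ^ 2 + θ) * (c0 / k - (T + c0) * u) ^ 2 - α * c0 ^ 2| ≤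
      (|θ| * c0 ^ 2 + (α + |θ|) * (C0 + 3 * |c0|) * (1 + |c0|)) * (1 / k + |T| / k ^ 2) := by
  have hk0 : 0 < k := by linarith
  have b4 := L0 C0 c0 k T u hk hC0 hT hu0 hu1
  have e : (α * k ^ 2 + θ) * (c0 / k - (T + c0) * u) ^ 2 - α * c0 ^ 2 =
     θ * c0 ^ 2 / k ^ 2 - (α * k ^ 2 + θ) * (((T + c0) * u) * (2 * (c0 / k) - (T + c0) * u)) := by
    field_simp; ring
  have b1 : |θ * c0 ^ 2 / k ^ 2| ≤ |θ| * c0 ^ 2 * (1 / k) := by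
    rw [abs_div, abs_mul, abs_of_nonneg (sq_nonneg c0), abs_of_nonneg (sq_nonneg k)]
    rw [div_eq_mul_one_div]
    gcongr
    nlinarith
  have b2 : |2 * (c0 / k) - (T + c0) * u| ≤ (C0 + 3 * |c0|) / k := by
    have := abs_sub (2 * (c0 / k)) ((T + c0) * u)
    rw [abs_mul 2, abs_div, abs_of_pos hk0, abs_two] at this
    have e : (C0 + 3 * |c0|) / k = 2 * (|c0| / k) + (C0 + |c0|) / k := by ring
    linarith
  have b3 : |(T + c0) * u| ≤ (|T| + |c0|) / k ^ 3 := by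
    rw [abs_mul, abs_of_nonneg hu0]
    calc _ ≤ (|T| + |c0|) * (1 / (2 * k ^ 3)) := by gcongr; exact abs_add_le _ _
      _ = (|T| + |c0|) / k ^ 3 / 2 := by field_simp
      _ ≤ _ := half_le_self (by positivity)
  have b5 := Qb α θ k hα hk
  rw [e]
  have b6 : |(α * k ^ 2 + θ) * (((T + c0) * u) * (2 * (c0 / k) - (T + c0) * u))| ≤
     (α + |θ|) * (C0 + 3 * |c0|) * ((1 + |c0|) * (1 / k + |T| / k ^ 2)) := by
    rw [abs_mul, abs_mul]
    calc _ ≤ ((α + |θ|) * k ^ 2) * ((|T| + |c0|) / k ^ 3 * ((C0 + 3 * |c0|) / k)) := by gcongr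
      _ = (α + |θ|) * (C0 + 3 * |c0|) * ((|T| + |c0|) / k ^ 2) := by field_simp
      _ ≤ _ := by
        gcongr
        have h1 : |c0| / k ^ 2 ≤ |c0| * (1 / k) := by
          rw [div_eq_mul_one_div]; gcongr; nlinarith
        have h2 : 0 ≤ 1 / k := by positivity
        have h3 : 0 ≤ |c0| * (|T| / k ^ 2) := by positivity
        rw [add_div]
        linarith
  have t1 := abs_sub (θ * c0 ^ 2 / k ^ 2)
    ((α * k ^ 2 + θ) * (((T + c0) * u) * (2 * (c0 / k) - (T + c0) * u)))
  have h7 : 0 ≤ |θ| * c0 ^ 2 * (|T| / k ^ 2) := by positivity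
  linarith

set_option maxHeartbeats 1000000 in
lemma step_bound (α θ ρ C0 A c0 : ℝ) (hα : 0 ≤ α) (hα1 : α ≤ 1) (hC0 : 0 ≤ C0) (hA : 0 ≤ A)
    (c p : ℕ → ℝ) (r : ℕ) :
    ∃ C : ℝ, 0 ≤ C ∧ ∀ (k k1 T : ℝ) (B : ℕ → ℝ), 1 ≤ k → 0 < k1 → k1 ^ 2 = k ^ 2 + 1 →
      |T| ≤ C0 * k ^ 2 → (∀ i ∈ Finset.Icc 1 r, 0 ≤ B i ∧ B i ≤ k ^ 2) →
      (α * k ^ 2 + θ) * c0 + ∑ i ∈ Finset.Icc 1 r, ((i:ℝ) - α) * B i * c i = -ρ * T + θ * c0 →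
      ∀ t : ℝ, |t| ≤ A →
      ‖((α * k ^ 2 + θ : ℝ) : ℂ) * (Complex.exp (Complex.I * (t * ((T + c0) / k1 - T / k) : ℝ)) - 1)
        + ∑ i ∈ Finset.Icc 1 r, (((i:ℝ) - α) * B i : ℝ) *
          (Complex.exp (Complex.I * (t * (c i / k) : ℝ)) - 1)
        + (Complex.I * (t * ((ρ + α / 2) * (T / k)) : ℝ) + ((t ^ 2 / 2 *
          (α * c0 ^ 2 + ∑ i ∈ Finset.Icc 1 r, ((i:ℝ) - α) * p i * c i ^ 2) : ℝ) : ℂ))‖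
      ≤ C * |t| * (1 / k + |T| / k ^ 2 + ∑ i ∈ Finset.Icc 1 r, |B i / k ^ 2 - p i|) := by
  obtain ⟨D1, hD1⟩ : ∃ x : ℝ, x = |θ| * |c0| + α * C0 + α * |c0| + |θ| * (C0 + |c0|) := ⟨_, rfl⟩
  obtain ⟨D2, hD2⟩ : ∃ x : ℝ, x = |θ| * c0 ^ 2 + (α + |θ|) * (C0 + 3 * |c0|) * (1 + |c0|) := ⟨_, rfl⟩
  obtain ⟨D3, hD3⟩ : ∃ x : ℝ, x = ∑ i ∈ Finset.Icc 1 r, (i:ℝ) * c i ^ 2 := ⟨_, rfl⟩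
  obtain ⟨D4, hD4⟩ : ∃ x : ℝ, x = (α + |θ|) * (C0 + 2 * |c0|) ^ 3 + ∑ i ∈ Finset.Icc 1 r, (i:ℝ) * |c i| ^ 3 := ⟨_, rfl⟩
  have p1 : 0 ≤ D1 := by rw [hD1]; positivity
  have p2 : 0 ≤ D2 := by rw [hD2]; positivity
  have p3 : 0 ≤ D3 := by rw [hD3]; positivity
  have p4 : 0 ≤ D4 := by rw [hD4]; positivity
  refine ⟨D1 + A * (D2 + D3) + A ^ 2 * D4, by positivity, ?_⟩
  intro k k1 T B hk hk1 hkk hT hB hd t ht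
  have hk0 : 0 < k := by linarith
  obtain ⟨hu0, hu1, hu2⟩ := u_bounds k k1 hk hk1 hkk
  obtain ⟨u, hu⟩ : ∃ x : ℝ, x = 1 / k - 1 / k1 := ⟨_, rfl⟩
  rw [← hu] at hu0 hu1 hu2
  have eδ : (T + c0) / k1 - T / k = c0 / k - (T + c0) * u := by rw [hu]; ring
  have l0 := L0 C0 c0 k T u hk hC0 hT hu0 hu1
  have l1 := L1 α θ ρ C0 c0 hα hC0 k T u _ hk hT hu0 hu1 hu2 hd
  have l2 := L2 α θ C0 c0 hα hC0 k T u hk hT hu0 hu1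
  rw [← hD1] at l1
  rw [← hD2] at l2
  rw [eδ]
  obtain ⟨δ, hδ⟩ : ∃ x : ℝ, x = c0 / k - (T + c0) * u := ⟨_, rfl⟩
  rw [← hδ] at l1 l2 ⊢
  have l3 : |δ| ≤ (C0 + 2 * |c0|) / k := by
    have := abs_sub (c0 / k) ((T + c0) * u)
    rw [abs_div, abs_of_pos hk0] at this
    have e : (C0 + 2 * |c0|) / k = (|c0| / k) + (C0 + |c0|) / k := by ring
    rw [hδ]; linarith
  have hQ := Qb α θ k hα hk
  obtain ⟨H, hH⟩ : ∃ x : ℝ, x = ∑ i ∈ Finset.Icc 1 r, |B i / k ^ 2 - p i| := ⟨_, rfl⟩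
  have hH0 : 0 ≤ H := by rw [hH]; positivity
  -- second order
  have hi : ∀ i ∈ Finset.Icc 1 r, 0 ≤ (i:ℝ) - α ∧ (i:ℝ) - α ≤ i := by
    intro i hi
    have : (1:ℝ) ≤ i := by exact_mod_cast (Finset.mem_Icc.1 hi).1
    constructor <;> linarith
  have l4 : |∑ i ∈ Finset.Icc 1 r, ((i:ℝ) - α) * B i * (c i / k) ^ 2 -
      ∑ i ∈ Finset.Icc 1 r, ((i:ℝ) - α) * p i * c i ^ 2| ≤ D3 * H := by
    rw [← Finset.sum_sub_distrib]
    refine (Finset.abs_sum_le_sum_abs _ _).trans ?_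
    rw [hD3, Finset.sum_mul]
    apply Finset.sum_le_sum
    intro i hi'
    have e : ((i:ℝ) - α) * B i * (c i / k) ^ 2 - ((i:ℝ) - α) * p i * c i ^ 2 =
      ((i:ℝ) - α) * c i ^ 2 * (B i / k ^ 2 - p i) := by field_simp
    rw [e, abs_mul, abs_of_nonneg (mul_nonneg (hi i hi').1 (sq_nonneg _))]
    have h1 : |B i / k ^ 2 - p i| ≤ H :=
      hH ▸ Finset.single_le_sum (f := fun i => |B i / k ^ 2 - p i|) (fun _ _ => abs_nonneg _) hi'
    have h2 := hi i hi'
    have h3 : ((i:ℝ) - α) * c i ^ 2 ≤ (i:ℝ) * c i ^ 2 := mul_le_mul_of_nonneg_right h2.2 (sq_nonneg _)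
    exact mul_le_mul h3 h1 (abs_nonneg _) (by positivity)
  obtain ⟨f, hf⟩ : ∃ f : ℝ → ℂ, ∀ x : ℝ, f x = Complex.exp (Complex.I * x) - 1 - Complex.I * x + x ^ 2 / 2 :=
    ⟨_, fun _ => rfl⟩
  have hfb : ∀ x : ℝ, ‖f x‖ ≤ |x| ^ 3 := fun x => by rw [hf]; exact exp_bound3 x
  obtain ⟨S1, hS1⟩ : ∃ x : ℝ, x = ∑ i ∈ Finset.Icc 1 r, ((i:ℝ) - α) * B i * c i := ⟨_, rfl⟩
  rw [← hS1] at l1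
  have key : ((α * k ^ 2 + θ : ℝ) : ℂ) * (Complex.exp (Complex.I * (t * δ : ℝ)) - 1)
        + ∑ i ∈ Finset.Icc 1 r, (((i:ℝ) - α) * B i : ℝ) *
          (Complex.exp (Complex.I * (t * (c i / k) : ℝ)) - 1)
        + (Complex.I * (t * ((ρ + α / 2) * (T / k)) : ℝ) + ((t ^ 2 / 2 *
          (α * c0 ^ 2 + ∑ i ∈ Finset.Icc 1 r, ((i:ℝ) - α) * p i * c i ^ 2) : ℝ) : ℂ))
      = (((α * k ^ 2 + θ : ℝ) : ℂ) * f (t * δ)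
         + ∑ i ∈ Finset.Icc 1 r, (((i:ℝ) - α) * B i : ℝ) * f (t * (c i / k)))
        + Complex.I * (t * ((α * k ^ 2 + θ) * δ + S1 / k + (ρ + α / 2) * (T / k)) : ℝ)
        - ((t ^ 2 / 2 * (((α * k ^ 2 + θ) * δ ^ 2 - α * c0 ^ 2) +
           (∑ i ∈ Finset.Icc 1 r, ((i:ℝ) - α) * B i * (c i / k) ^ 2 -
            ∑ i ∈ Finset.Icc 1 r, ((i:ℝ) - α) * p i * c i ^ 2)) : ℝ) : ℂ) := by
    have e1 : ∑ i ∈ Finset.Icc 1 r, ((((i:ℝ) - α) * B i : ℝ) : ℂ) *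
          (Complex.exp (Complex.I * (t * (c i / k) : ℝ)) - 1) =
        ∑ i ∈ Finset.Icc 1 r, (((i:ℝ) - α) * B i : ℝ) * f (t * (c i / k)) +
        Complex.I * ((t * (S1 / k) : ℝ) : ℂ) -
        ((t ^ 2 / 2 * ∑ i ∈ Finset.Icc 1 r, ((i:ℝ) - α) * B i * (c i / k) ^ 2 : ℝ) : ℂ) := by
      rw [hS1, Finset.sum_div, Finset.mul_sum, Finset.mul_sum, Complex.ofReal_sum,
        Complex.ofReal_sum, Finset.mul_sum, ← Finset.sum_add_distrib, ← Finset.sum_sub_distrib]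
      apply Finset.sum_congr rfl
      intro i _
      simp only [hf]; push_cast; ring
    rw [e1]
    simp only [hf]; push_cast; ring
  rw [key]
  have n1 : ‖((α * k ^ 2 + θ : ℝ) : ℂ) * f (t * δ)
         + ∑ i ∈ Finset.Icc 1 r, (((i:ℝ) - α) * B i : ℝ) * f (t * (c i / k))‖ ≤
       |t| ^ 3 * (D4 * (1 / k)) := by
    refine (norm_add_le _ _).trans ?_
    rw [hD4, add_mul, mul_add (|t| ^ 3)]
    apply add_le_add
    · rw [norm_mul, Complex.norm_real, Real.norm_eq_abs]
      calc _ ≤ ((α + |θ|) * k ^ 2) * (|t| * ((C0 + 2 * |c0|) / k)) ^ 3 := by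
            gcongr
            refine (hfb _).trans ?_
            rw [abs_mul]; gcongr
        _ = _ := by field_simp
    · refine (norm_sum_le _ _).trans ?_
      rw [Finset.sum_mul, Finset.mul_sum]
      apply Finset.sum_le_sum
      intro i hi'
      have h2 := hi i hi'
      have h3 := hB i hi'
      rw [norm_mul, Complex.norm_real, Real.norm_eq_abs, abs_of_nonneg (mul_nonneg h2.1 h3.1)]
      calc _ ≤ ((i:ℝ) * k ^ 2) * (|t| * (|c i| / k)) ^ 3 := by
            gcongr
            · exact h3.1
            · exact h2.2
            · exact h3.2
            · refine (hfb _).trans ?_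
              rw [abs_mul, abs_div, abs_of_pos hk0]
        _ = _ := by field_simp
  have n2 : ‖Complex.I * ((t * ((α * k ^ 2 + θ) * δ + S1 / k + (ρ + α / 2) * (T / k)) : ℝ) : ℂ)‖
      ≤ |t| * (D1 * (1 / k)) := by
    rw [norm_mul, Complex.norm_I, one_mul, Complex.norm_real, Real.norm_eq_abs, abs_mul,
      mul_one_div]
    gcongr
  have n3 : ‖((t ^ 2 / 2 * (((α * k ^ 2 + θ) * δ ^ 2 - α * c0 ^ 2) +
           (∑ i ∈ Finset.Icc 1 r, ((i:ℝ) - α) * B i * (c i / k) ^ 2 -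
            ∑ i ∈ Finset.Icc 1 r, ((i:ℝ) - α) * p i * c i ^ 2)) : ℝ) : ℂ)‖ ≤
       |t| ^ 2 * (D2 * (1 / k + |T| / k ^ 2) + D3 * H) := by
    rw [Complex.norm_real, Real.norm_eq_abs, abs_mul, abs_of_nonneg (show 0 ≤ t ^ 2 / 2 by positivity),
      sq_abs]
    apply mul_le_mul _ _ (abs_nonneg _) (by positivity)
    · exact half_le_self (sq_nonneg t)
    · exact (abs_add_le _ _).trans (add_le_add l2 l4)
  refine (norm_sub_le _ _).trans ((add_le_add ((norm_add_le _ _).trans (add_le_add n1 n2)) n3).trans ?_)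
  obtain ⟨X, hX⟩ : ∃ x : ℝ, x = 1 / k + |T| / k ^ 2 + H := ⟨_, rfl⟩
  have x1 : 1 / k ≤ X := by
    have : 0 ≤ |T| / k ^ 2 := by positivity
    linarith
  have x2 : 1 / k + |T| / k ^ 2 ≤ X := by linarith
  have x3 : H ≤ X := by
    have : 0 ≤ |T| / k ^ 2 := by positivity
    have : 0 ≤ 1 / k := by positivity
    linarith
  rw [← hH, ← hX]
  have hX0 : 0 ≤ X := hH0.trans x3
  calc _ ≤ (|t| * A ^ 2) * (D4 * X) + |t| * (D1 * X) + (|t| * A) * (D2 * X + D3 * X) := by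
        have a1 : |t| ^ 3 ≤ |t| * A ^ 2 := by
          rw [pow_succ']; gcongr
        have a2 : |t| ^ 2 ≤ |t| * A := by
          rw [sq]; gcongr
        gcongr
    _ = _ := by ring

end

section

def Tn (α : ℝ) (r : ℕ) {Ω : Type*} (K : ℕ → Ω → ℕ) (B : ℕ → ℕ → Ω → ℕ) (n : ℕ) (ω : Ω) : ℝ :=
  ∑ i ∈ Finset.Icc 1 r, bCoef α r i * (B i n ω : ℝ) - bCoef α r 0 * (K n ω : ℝ)

def evNew {Ω : Type*} (K : ℕ → Ω → ℕ) (B : ℕ → ℕ → Ω → ℕ) (n : ℕ) : Set Ω :=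
  {ω | K (n+1) ω = K n ω + 1 ∧ B 1 (n+1) ω = B 1 n ω + 1 ∧
        ∀ s, 2 ≤ s → B s (n+1) ω = B s n ω}

def evGrow {Ω : Type*} (K : ℕ → Ω → ℕ) (B : ℕ → ℕ → Ω → ℕ) (n r : ℕ) : Set Ω :=
  {ω | K (n+1) ω = K n ω ∧ B r (n+1) ω + 1 = B r n ω ∧
        B (r+1) (n+1) ω = B (r+1) n ω + 1 ∧
        ∀ s, 1 ≤ s → s ≠ r → s ≠ r + 1 → B s (n+1) ω = B s n ω}

section
variable {α θ : ℝ} {Ω : Type*} {mΩ : MeasurableSpace Ω}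
    {μ : Measure Ω} {F : Filtration ℕ mΩ} {K : ℕ → Ω → ℕ} {B : ℕ → ℕ → Ω → ℕ}

lemma T_new {r n : ℕ} (hr : 1 ≤ r) {ω : Ω} (h : ω ∈ evNew K B n) :
    Tn α r K B (n+1) ω = Tn α r K B n ω + cc α r 0 := by
  obtain ⟨h1, h2, h3⟩ := h
  rw [← bCoef_sub α r 0 (by omega)]
  have : ∀ i ∈ Finset.Icc 1 r, bCoef α r i * (B i (n+1) ω : ℝ) =
      bCoef α r i * (B i n ω : ℝ) + if i = 1 then bCoef α r i else 0 := by
    intro i hi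
    rcases eq_or_ne i 1 with rfl | hne
    · rw [h2, if_pos rfl]; push_cast; ring
    · rw [h3 i (by simp at hi; omega)]; simp [hne]
  rw [Tn, Tn, Finset.sum_congr rfl this, Finset.sum_add_distrib, h1]
  simp [hr]; ring

lemma T_grow {r n j : ℕ} (hj : 1 ≤ j) {ω : Ω} (h : ω ∈ evGrow K B n j) :
    Tn α r K B (n+1) ω = Tn α r K B n ω + if j ≤ r then cc α r j else 0 := by
  obtain ⟨h1, h2, h3, h4⟩ := h
  have : ∀ i ∈ Finset.Icc 1 r, bCoef α r i * (B i (n+1) ω : ℝ) =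
      bCoef α r i * (B i n ω : ℝ) + ((if i = j + 1 then bCoef α r i else 0)
        - if i = j then bCoef α r i else 0) := by
    intro i hi
    rcases eq_or_ne i j with rfl | hne
    · rw [← h2, if_neg (by omega), if_pos rfl]; push_cast; ring
    · rcases eq_or_ne i (j+1) with rfl | hne2
      · rw [h3, if_pos rfl, if_neg (by omega)]; push_cast; ring
      · rw [h4 i (by simp at hi; omega) hne hne2]; simp [hne, hne2]
  rw [Tn, Tn, Finset.sum_congr rfl this, Finset.sum_add_distrib, Finset.sum_sub_distrib, h1]
  simp only [Finset.sum_ite_eq', Finset.mem_Icc]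
  rcases lt_trichotomy j r with hlt | rfl | hgt
  · rw [← bCoef_sub α r j hlt, if_pos (by omega), if_pos (by omega), if_pos (by omega)]; ring
  · rw [cc_self, bCoef_self, if_neg (by omega), if_pos (by omega), if_pos le_rfl]; ring
  · rw [if_neg (by omega), if_neg (by omega), if_neg (by omega)]; ring

lemma disj_new_grow {n j : ℕ} {ω : Ω} (h : ω ∈ evNew K B n) : ω ∉ evGrow K B n j := by
  intro h'; have := h.1; have := h'.1; omega

lemma disj_grow_grow {n i j : ℕ} (hi : 1 ≤ i) (hj : 1 ≤ j) {ω : Ω} (h : ω ∈ evGrow K B n i)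
    (h' : ω ∈ evGrow K B n j) : i = j := by
  obtain ⟨h1, h2, h3, h4⟩ := h
  obtain ⟨g1, g2, g3, g4⟩ := h'
  rcases lt_trichotomy i j with hlt | rfl | hgt
  · have := g4 i hi (by omega) (by omega); omega
  · rfl
  · have := h4 j hj (by omega) (by omega); omega

variable (hEP : IsEwensPitman α θ μ F K B)
include hEP

lemma meas_K' (n : ℕ) : Measurable (K n) := (hEP.meas_K n).mono (F.le n) le_rfl
lemma meas_B' (i n : ℕ) : Measurable (B i n) := (hEP.meas_B i n).mono (F.le n) le_rfl

lemma measSet_new (n : ℕ) : MeasurableSet (evNew K B n) := by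
  have hK := meas_K' hEP
  have hB := meas_B' hEP
  have e : evNew K B n = {ω | K (n+1) ω = K n ω + 1} ∩ ({ω | B 1 (n+1) ω = B 1 n ω + 1} ∩
      ⋂ s, ⋂ (_ : 2 ≤ s), {ω | B s (n+1) ω = B s n ω}) := by
    ext ω; simp [evNew]
  rw [e]
  refine (measurableSet_eq_fun (hK _) ((hK _).add_const _)).inter
    ((measurableSet_eq_fun (hB _ _) ((hB _ _).add_const _)).inter ?_)
  exact MeasurableSet.iInter fun s => MeasurableSet.iInter fun _ =>
    measurableSet_eq_fun (hB _ _) (hB _ _)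

lemma measSet_grow (n r : ℕ) : MeasurableSet (evGrow K B n r) := by
  have hK := meas_K' hEP
  have hB := meas_B' hEP
  have e : evGrow K B n r = {ω | K (n+1) ω = K n ω} ∩ ({ω | B r (n+1) ω + 1 = B r n ω} ∩
     ({ω | B (r+1) (n+1) ω = B (r+1) n ω + 1} ∩
      ⋂ s, ⋂ (_ : 1 ≤ s), ⋂ (_ : s ≠ r), ⋂ (_ : s ≠ r + 1), {ω | B s (n+1) ω = B s n ω})) := by
    ext ω; simp [evGrow]
  rw [e]
  refine (measurableSet_eq_fun (hK _) (hK _)).inter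
    ((measurableSet_eq_fun ((hB _ _).add_const _) (hB _ _)).inter
    ((measurableSet_eq_fun (hB _ _) ((hB _ _).add_const _)).inter ?_))
  exact MeasurableSet.iInter fun s => MeasurableSet.iInter fun _ => MeasurableSet.iInter fun _ =>
    MeasurableSet.iInter fun _ => measurableSet_eq_fun (hB _ _) (hB _ _)

/-- basic a.e. facts -/
lemma ae_basic (n : ℕ) (hn : 1 ≤ n) : ∀ᵐ ω ∂μ, 1 ≤ K n ω ∧ K n ω ≤ n ∧
    (∀ i, 1 ≤ i → B i n ω ≤ K n ω) ∧ K n ω = ∑ r ∈ Finset.Icc 1 n, B r n ω ∧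
    n = ∑ r ∈ Finset.Icc 1 n, r * B r n ω := by
  have hz : ∀ᵐ ω ∂μ, ∀ i, n < i → B i n ω = 0 := by
    rw [ae_all_iff]; intro i
    by_cases h : n < i
    · filter_upwards [hEP.B_eq_zero i n h] with ω hω _ using hω
    · exact Eventually.of_forall fun _ h' => absurd h' h
  filter_upwards [hEP.sum_blocks n hn, hEP.sum_sizes n hn, hz] with ω h1 h2 h3
  refine ⟨?_, ?_, ?_, h1, h2⟩
  · by_contra hc
    have : K n ω = 0 := by omega
    rw [this] at h1
    have h4 := Finset.sum_eq_zero_iff.1 h1.symm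
    have : ∑ r ∈ Finset.Icc 1 n, r * B r n ω = 0 :=
      Finset.sum_eq_zero fun i hi => by rw [h4 i hi, mul_zero]
    omega
  · rw [h1]
    conv_rhs => rw [h2]
    apply Finset.sum_le_sum
    intro i hi
    exact Nat.le_mul_of_pos_left _ (Finset.mem_Icc.1 hi).1
  · intro i hi
    by_cases h : n < i
    · rw [h3 i h]; omega
    · rw [h1]
      exact Finset.single_le_sum (f := fun i => B i n ω) (fun _ _ => Nat.zero_le _)
        (Finset.mem_Icc.2 ⟨hi, by omega⟩)

lemma ae_cover (hθ : -1 < θ) (n : ℕ) (hn : 1 ≤ n) :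
    ∀ᵐ ω ∂μ, ω ∈ evNew K B n ∨ ∃ i, 1 ≤ i ∧ ω ∈ evGrow K B n i := by
  have := hEP.prob
  have hp : (0:ℝ) < n + θ := by
    have : (1:ℝ) ≤ n := by exact_mod_cast hn
    linarith
  set S : Ω → ℝ := fun ω => (evNew K B n).indicator (fun _ => (1:ℝ)) ω +
    ∑ i ∈ Finset.Icc 1 n, (evGrow K B n i).indicator (fun _ => (1:ℝ)) ω with hS
  have i0 : Integrable ((evNew K B n).indicator (fun _ => (1:ℝ))) μ :=
    (integrable_const 1).indicator (measSet_new hEP n)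
  have ii : ∀ i, Integrable ((evGrow K B n i).indicator (fun _ => (1:ℝ))) μ := fun i =>
    (integrable_const 1).indicator (measSet_grow hEP n i)
  have q0 : μ[(evNew K B n).indicator (fun _ => (1:ℝ)) | F n]
      =ᵐ[μ] fun ω => (α * (K n ω : ℝ) + θ) / ((n : ℝ) + θ) := hEP.trans_new n hn
  have qi : ∀ i, 1 ≤ i → μ[(evGrow K B n i).indicator (fun _ => (1:ℝ)) | F n]
      =ᵐ[μ] fun ω => (((i : ℝ) - α) * (B i n ω : ℝ)) / ((n : ℝ) + θ) := hEP.trans_grow n hn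
  have hSle : ∀ ω, S ω ≤ 1 := by
    intro ω
    by_cases h0 : ω ∈ evNew K B n
    · have : ∀ i ∈ Finset.Icc 1 n, (evGrow K B n i).indicator (fun _ => (1:ℝ)) ω = 0 := fun i _ =>
        Set.indicator_of_notMem (disj_new_grow h0) _
      simp only [hS]
      rw [Finset.sum_eq_zero this, Set.indicator_of_mem h0]; norm_num
    · by_cases h1 : ∃ i ∈ Finset.Icc 1 n, ω ∈ evGrow K B n i
      · obtain ⟨i, hi, hω⟩ := h1
        simp only [hS]
        rw [Set.indicator_of_notMem h0, Finset.sum_eq_single_of_mem i hi,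
          Set.indicator_of_mem hω]
        · norm_num
        · intro j hj hne
          refine Set.indicator_of_notMem (fun h => hne ?_) _
          exact disj_grow_grow (Finset.mem_Icc.1 hj).1 (Finset.mem_Icc.1 hi).1 h hω
      · push Not at h1
        simp only [hS]
        rw [Set.indicator_of_notMem h0, Finset.sum_eq_zero fun i hi =>
          Set.indicator_of_notMem (h1 i hi) _]
        norm_num
  have hSint : Integrable S μ := i0.add (integrable_finsetSum _ fun i _ => ii i)
  have hS1 : ∫ ω, S ω ∂μ = 1 := by
    have e1 : ∫ ω, S ω ∂μ = ∫ ω, ((α * (K n ω : ℝ) + θ) / ((n : ℝ) + θ) +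
        ∑ i ∈ Finset.Icc 1 n, (((i : ℝ) - α) * (B i n ω : ℝ)) / ((n : ℝ) + θ)) ∂μ := by
      rw [integral_add i0 (integrable_finsetSum _ fun i _ => ii i),
        integral_finsetSum _ fun i _ => ii i]
      rw [integral_add (integrable_condExp.congr q0)
        (integrable_finsetSum _ fun i hi => integrable_condExp.congr (qi i (Finset.mem_Icc.1 hi).1)),
        integral_finsetSum _ fun i hi => integrable_condExp.congr (qi i (Finset.mem_Icc.1 hi).1)]
      congr 1
      · rw [← integral_congr_ae q0, integral_condExp]
      · refine Finset.sum_congr rfl fun i hi => ?_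
        rw [← integral_congr_ae (qi i (Finset.mem_Icc.1 hi).1), integral_condExp]
    rw [e1]
    have e2 : ∀ᵐ ω ∂μ, ((α * (K n ω : ℝ) + θ) / ((n : ℝ) + θ) +
        ∑ i ∈ Finset.Icc 1 n, (((i : ℝ) - α) * (B i n ω : ℝ)) / ((n : ℝ) + θ)) = 1 := by
      filter_upwards [ae_basic hEP n hn] with ω ⟨_, _, _, h1, h2⟩
      rw [← Finset.sum_div, ← add_div, div_eq_one_iff_eq hp.ne']
      have h1' : (K n ω : ℝ) = ∑ r ∈ Finset.Icc 1 n, (B r n ω : ℝ) := by exact_mod_cast h1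
      have h2' : (n : ℝ) = ∑ r ∈ Finset.Icc 1 n, (r:ℝ) * (B r n ω : ℝ) := by exact_mod_cast h2
      simp_rw [sub_mul]
      rw [Finset.sum_sub_distrib, ← h2', ← Finset.mul_sum, ← h1']; ring
    rw [integral_congr_ae e2]; simp
  have hz : ∫ ω, (1 - S ω) ∂μ = 0 := by
    rw [integral_sub (integrable_const _) hSint, hS1]; simp
  rw [integral_eq_zero_iff_of_nonneg (fun ω => sub_nonneg.2 (hSle ω))
    ((integrable_const _).sub hSint)] at hz
  filter_upwards [hz] with ω hω
  by_contra hc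
  push Not at hc
  have : S ω = 0 := by
    simp only [hS]
    rw [Set.indicator_of_notMem hc.1, Finset.sum_eq_zero fun i hi =>
          Set.indicator_of_notMem (hc.2 i (Finset.mem_Icc.1 hi).1) _]
    norm_num
  simp [this] at hω

lemma pull_out {E : Type*} [NormedAddCommGroup E] [NormedSpace ℝ E] [CompleteSpace E]
    (n : ℕ) (A : Set Ω) (hA : MeasurableSet A) (q : Ω → ℝ)
    (hq : μ[A.indicator (fun _ => (1:ℝ)) | F n] =ᵐ[μ] q) (D : Ω → E)
    (hD : StronglyMeasurable[F n] D) (hDi : Integrable D μ) :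
    Integrable (fun ω => q ω • D ω) μ ∧ ∫ ω, A.indicator D ω ∂μ = ∫ ω, q ω • D ω ∂μ := by
  have := hEP.prob
  have e : A.indicator D = A.indicator (fun _ => (1:ℝ)) • D := by
    ext ω; by_cases h : ω ∈ A <;> simp [h]
  have hi : Integrable (A.indicator (fun _ => (1:ℝ)) • D) μ := e ▸ hDi.indicator hA
  have h := condExp_smul_of_aestronglyMeasurable_right (m := F n) (μ := μ)
    ((integrable_const (1:ℝ)).indicator hA) hi hD.aestronglyMeasurable
  have h2 : μ[A.indicator (fun _ => (1:ℝ)) • D | F n] =ᵐ[μ] fun ω => q ω • D ω := by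
    filter_upwards [h, hq] with ω h1 h2
    rw [h1, Pi.smul_apply', h2]
  refine ⟨integrable_condExp.congr h2, ?_⟩
  rw [← integral_congr_ae h2, integral_condExp, e]

end
end

section
section
variable {α θ : ℝ} {Ω : Type*} {mΩ : MeasurableSpace Ω}
    {μ : Measure Ω} {F : Filtration ℕ mΩ} {K : ℕ → Ω → ℕ} {B : ℕ → ℕ → Ω → ℕ}

variable (hEP : IsEwensPitman α θ μ F K B)
include hEP

lemma meas_T (r n : ℕ) : Measurable[F n] (Tn α r K B n) := by
  have h1 := hEP.meas_K n
  have h2 := fun i => hEP.meas_B i n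
  unfold Tn
  refine Measurable.sub (Finset.measurable_fun_sum _ fun i _ => ?_) ?_
  · exact (measurable_from_top.comp (h2 i)).const_mul _
  · exact (measurable_from_top.comp h1).const_mul _

lemma meas_g {E : Type*} [TopologicalSpace E] [MeasurableSpace E] [BorelSpace E]
    (r n : ℕ) (g : ℝ → ℕ → E) (hg : ∀ k, Continuous fun x => g x k) (c : ℝ) (e : ℕ) :
    Measurable[F n] (fun ω => g (Tn α r K B n ω + c) (K n ω + e)) := by
  have hm : Measurable (fun p : ℕ × ℝ => g p.2 p.1) :=
    measurable_from_prod_countable_right fun k => (hg k).measurable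
  exact hm.comp (((hEP.meas_K n).add_const e).prodMk ((meas_T hEP r n).add_const c))

lemma meas_g0 {E : Type*} [TopologicalSpace E] [MeasurableSpace E] [BorelSpace E]
    (r n : ℕ) (g : ℝ → ℕ → E) (hg : ∀ k, Continuous fun x => g x k) :
    Measurable (fun ω => g (Tn α r K B n ω) (K n ω)) := by
  simpa using (meas_g hEP r n g hg 0 0).mono (F.le n) le_rfl

lemma markov {E : Type*} [NormedAddCommGroup E] [NormedSpace ℝ E] [CompleteSpace E]
    [MeasurableSpace E] [BorelSpace E] [SecondCountableTopology E]
    (hθ : -1 < θ) (r n : ℕ) (hr : 1 ≤ r) (hn : 1 ≤ n)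
    (g : ℝ → ℕ → E) (hg : ∀ k, Continuous fun x => g x k)
    (hi : Integrable (fun ω => g (Tn α r K B n ω) (K n ω)) μ)
    (hi0 : Integrable (fun ω => g (Tn α r K B n ω + cc α r 0) (K n ω + 1)) μ)
    (hii : ∀ i ∈ Finset.Icc 1 r, Integrable (fun ω => g (Tn α r K B n ω + cc α r i) (K n ω)) μ) :
    let L := fun ω => ((α * (K n ω : ℝ) + θ) / ((n : ℝ) + θ)) •
        (g (Tn α r K B n ω + cc α r 0) (K n ω + 1) - g (Tn α r K B n ω) (K n ω)) +
      ∑ i ∈ Finset.Icc 1 r, ((((i : ℝ) - α) * (B i n ω : ℝ)) / ((n : ℝ) + θ)) •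
        (g (Tn α r K B n ω + cc α r i) (K n ω) - g (Tn α r K B n ω) (K n ω))
    Integrable L μ ∧
    ∫ ω, g (Tn α r K B (n+1) ω) (K (n+1) ω) ∂μ = ∫ ω, g (Tn α r K B n ω) (K n ω) ∂μ + ∫ ω, L ω ∂μ := by
  intro L
  have := hEP.prob
  set D0 : Ω → E := fun ω => g (Tn α r K B n ω + cc α r 0) (K n ω + 1) - g (Tn α r K B n ω) (K n ω) with hD0
  set D : ℕ → Ω → E := fun i ω => g (Tn α r K B n ω + cc α r i) (K n ω) - g (Tn α r K B n ω) (K n ω) with hD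
  have mg : StronglyMeasurable[F n] (fun ω => g (Tn α r K B n ω) (K n ω)) := by
    simpa using (meas_g hEP r n g hg 0 0).stronglyMeasurable
  have mD0 : StronglyMeasurable[F n] D0 := (meas_g hEP r n g hg _ 1).stronglyMeasurable.sub mg
  have mD : ∀ i, StronglyMeasurable[F n] (D i) := fun i =>
    (by simpa using (meas_g hEP r n g hg (cc α r i) 0).stronglyMeasurable :
      StronglyMeasurable[F n] (fun ω => g (Tn α r K B n ω + cc α r i) (K n ω))).sub mg
  have iD0 : Integrable D0 μ := hi0.sub hi
  have iD : ∀ i ∈ Finset.Icc 1 r, Integrable (D i) μ := fun i h => (hii i h).sub hi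
  have p0 := pull_out hEP n (evNew K B n) (measSet_new hEP n) _ (hEP.trans_new n hn) D0 mD0 iD0
  have pi : ∀ i ∈ Finset.Icc 1 r, _ := fun i h => pull_out hEP n (evGrow K B n i) (measSet_grow hEP n i) _
    (hEP.trans_grow n hn i (Finset.mem_Icc.1 h).1) (D i) (mD i) (iD i h)
  have iS : Integrable (fun ω => ∑ i ∈ Finset.Icc 1 r, ((((i : ℝ) - α) * (B i n ω : ℝ)) / ((n : ℝ) + θ)) • D i ω) μ :=
    integrable_finsetSum _ fun i h => (pi i h).1
  have iSI : Integrable (fun ω => ∑ i ∈ Finset.Icc 1 r, (evGrow K B n i).indicator (D i) ω) μ :=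
    integrable_finsetSum _ fun i h => (iD i h).indicator (measSet_grow hEP n i)
  have hL : Integrable L μ := p0.1.add iS
  refine ⟨hL, ?_⟩
  have hae : ∀ᵐ ω ∂μ, g (Tn α r K B (n+1) ω) (K (n+1) ω) = g (Tn α r K B n ω) (K n ω) +
      ((evNew K B n).indicator D0 ω + ∑ i ∈ Finset.Icc 1 r, (evGrow K B n i).indicator (D i) ω) := by
    filter_upwards [ae_cover hEP hθ n hn] with ω hω
    rcases hω with h0 | ⟨j, hj, h1⟩
    · rw [Set.indicator_of_mem h0, Finset.sum_eq_zero fun i _ =>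
        Set.indicator_of_notMem (disj_new_grow h0) _, T_new hr h0, h0.1, hD0]
      simp
    · have h0 : ω ∉ evNew K B n := fun h => disj_new_grow h h1
      rw [Set.indicator_of_notMem h0, T_grow hj h1, h1.1]
      by_cases hjr : j ≤ r
      · rw [if_pos hjr, Finset.sum_eq_single_of_mem j (Finset.mem_Icc.2 ⟨hj, hjr⟩),
          Set.indicator_of_mem h1, hD]
        · simp
        · intro i hi' hne
          exact Set.indicator_of_notMem
            (fun h => hne (disj_grow_grow (Finset.mem_Icc.1 hi').1 hj h h1)) _
      · rw [if_neg hjr, Finset.sum_eq_zero]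
        · simp
        · intro i hi'
          refine Set.indicator_of_notMem
            (fun h => ?_) _
          have := disj_grow_grow (Finset.mem_Icc.1 hi').1 hj h h1
          have := (Finset.mem_Icc.1 hi').2
          omega
  rw [integral_congr_ae hae, integral_add hi, integral_add (iD0.indicator (measSet_new hEP n)) iSI,
    integral_finsetSum _ fun i h => (iD i h).indicator (measSet_grow hEP n i), p0.2]
  · congr 1
    rw [integral_add p0.1 iS, integral_finsetSum _ fun i h => (pi i h).1]
    congr 1
    exact Finset.sum_congr rfl fun i h => (pi i h).2
  · exact (iD0.indicator (measSet_new hEP n)).add iSI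

end
end

section
section
variable {α θ : ℝ} {Ω : Type*} {mΩ : MeasurableSpace Ω}
    {μ : Measure Ω} {F : Filtration ℕ mΩ} {K : ℕ → Ω → ℕ} {B : ℕ → ℕ → Ω → ℕ}

lemma drift (r : ℕ) (n : ℕ) (ω : Ω) :
    (α * (K n ω : ℝ) + θ) * cc α r 0 + ∑ i ∈ Finset.Icc 1 r, ((i : ℝ) - α) * (B i n ω : ℝ) * cc α r i
      = -((r : ℝ) - α) * Tn α r K B n ω + θ * cc α r 0 := by
  have h0 := cc_eigen α r 0 (Nat.zero_le _)
  have h1 : ∀ i ∈ Finset.Icc 1 r, ((i : ℝ) - α) * (B i n ω : ℝ) * cc α r i =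
      -((r : ℝ) - α) * (bCoef α r i * (B i n ω : ℝ)) := fun i hi => by
    have := cc_eigen α r i (Finset.mem_Icc.1 hi).2
    linear_combination (B i n ω : ℝ) * this
  rw [Finset.sum_congr rfl h1, ← Finset.mul_sum, Tn]
  push_cast at h0
  linear_combination (-(K n ω : ℝ)) * h0

def C0 (α : ℝ) (r : ℕ) : ℝ := ∑ i ∈ Finset.Icc 1 r, |bCoef α r i| + |bCoef α r 0|

lemma C0_nonneg (α : ℝ) (r : ℕ) : 0 ≤ C0 α r :=
  add_nonneg (Finset.sum_nonneg fun _ _ => abs_nonneg _) (abs_nonneg _)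

lemma T_bound (r n : ℕ) (ω : Ω) (h : ∀ i, 1 ≤ i → B i n ω ≤ K n ω) :
    |Tn α r K B n ω| ≤ C0 α r * (K n ω : ℝ) := by
  unfold Tn C0
  refine (abs_sub _ _).trans ?_
  rw [add_mul, Finset.sum_mul, abs_mul, Nat.abs_cast]
  refine add_le_add ((Finset.abs_sum_le_sum_abs _ _).trans (Finset.sum_le_sum fun i hi => ?_)) le_rfl
  rw [abs_mul, Nat.abs_cast]
  exact mul_le_mul_of_nonneg_left (by exact_mod_cast h i (Finset.mem_Icc.1 hi).1) (abs_nonneg _)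

variable (hEP : IsEwensPitman α θ μ F K B)
include hEP

lemma int_any {E : Type*} [NormedAddCommGroup E] 
    [MeasurableSpace E] [BorelSpace E] [SecondCountableTopology E]
    (r n : ℕ) (hn : 1 ≤ n) (g : ℝ → ℕ → E) (hg : ∀ k, Continuous fun x => g x k) (c : ℝ) (e : ℕ) :
    Integrable (fun ω => g (Tn α r K B n ω + c) (K n ω + e)) μ := by
  have := hEP.prob
  have hm : Measurable (fun ω => g (Tn α r K B n ω + c) (K n ω + e)) :=
    (meas_g hEP r n g hg c e).mono (F.le n) le_rfl
  have hb : ∀ k, ∃ C : ℝ, ∀ x ∈ Set.Icc (-(C0 α r * n + |c|)) (C0 α r * n + |c|), ‖g x k‖ ≤ C :=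
    fun k => isCompact_Icc.exists_bound_of_continuousOn (hg k).continuousOn
  choose C hC using hb
  refine Integrable.of_bound hm.aestronglyMeasurable (∑ k ∈ Finset.range (n + 1), |C (k + e)|) ?_
  filter_upwards [ae_basic hEP n hn] with ω ⟨h1, h2, h3, _⟩
  have hT := T_bound (α := α) r n ω h3
  have hK : (K n ω : ℝ) ≤ n := by exact_mod_cast h2
  have h4 := C0_nonneg α r
  have h5 : |Tn α r K B n ω + c| ≤ C0 α r * n + |c| := by
    refine (abs_add_le _ _).trans ?_
    have := mul_le_mul_of_nonneg_left hK h4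
    linarith
  refine (hC (K n ω + e) _ (abs_le.1 h5)).trans ((le_abs_self _).trans ?_)
  exact Finset.single_le_sum (f := fun k => |C (k + e)|) (fun _ _ => abs_nonneg _)
    (Finset.mem_range.2 (by omega))

lemma int_0 {E : Type*} [NormedAddCommGroup E] 
    [MeasurableSpace E] [BorelSpace E] [SecondCountableTopology E]
    (r n : ℕ) (hn : 1 ≤ n) (g : ℝ → ℕ → E) (hg : ∀ k, Continuous fun x => g x k) :
    Integrable (fun ω => g (Tn α r K B n ω) (K n ω)) μ := by
  simpa using int_any hEP r n hn g hg 0 0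

lemma markov2 {E : Type*} [NormedAddCommGroup E] [NormedSpace ℝ E] [CompleteSpace E]
    [MeasurableSpace E] [BorelSpace E] [SecondCountableTopology E]
    (hθ : -1 < θ) (r n : ℕ) (hr : 1 ≤ r) (hn : 1 ≤ n)
    (g : ℝ → ℕ → E) (hg : ∀ k, Continuous fun x => g x k) :
    let L := fun ω => (α * (K n ω : ℝ) + θ) •
        (g (Tn α r K B n ω + cc α r 0) (K n ω + 1) - g (Tn α r K B n ω) (K n ω)) +
      ∑ i ∈ Finset.Icc 1 r, (((i : ℝ) - α) * (B i n ω : ℝ)) •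
        (g (Tn α r K B n ω + cc α r i) (K n ω) - g (Tn α r K B n ω) (K n ω))
    Integrable L μ ∧
    ∫ ω, g (Tn α r K B (n+1) ω) (K (n+1) ω) ∂μ = ∫ ω, g (Tn α r K B n ω) (K n ω) ∂μ
      + (1 / ((n : ℝ) + θ)) • ∫ ω, L ω ∂μ := by
  intro L
  have hp : (0:ℝ) < n + θ := by
    have : (1:ℝ) ≤ n := by exact_mod_cast hn
    linarith
  have h := markov hEP hθ r n hr hn g hg (int_0 hEP r n hn g hg) (int_any hEP r n hn g hg _ 1)
    (fun i _ => by simpa using int_any hEP r n hn g hg (cc α r i) 0)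
  have e : (fun ω => ((α * (K n ω : ℝ) + θ) / ((n : ℝ) + θ)) •
        (g (Tn α r K B n ω + cc α r 0) (K n ω + 1) - g (Tn α r K B n ω) (K n ω)) +
      ∑ i ∈ Finset.Icc 1 r, ((((i : ℝ) - α) * (B i n ω : ℝ)) / ((n : ℝ) + θ)) •
        (g (Tn α r K B n ω + cc α r i) (K n ω) - g (Tn α r K B n ω) (K n ω)))
      = fun ω => (1 / ((n : ℝ) + θ)) • L ω := by
    funext ω
    simp only [L, smul_add, Finset.smul_sum, smul_smul]
    congr 1
    · congr 1; ring
    · refine Finset.sum_congr rfl fun i _ => ?_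
      congr 1; ring
  simp only [e] at h
  refine ⟨?_, ?_⟩
  · have := h.1.smul ((n : ℝ) + θ)
    have e2 : (((n : ℝ) + θ) • fun ω => (1 / ((n : ℝ) + θ)) • L ω) = L := by
      funext ω
      simp only [Pi.smul_apply, smul_smul]
      rw [mul_one_div_cancel hp.ne', one_smul]
    rwa [e2] at this
  · rw [h.2, integral_smul]

lemma invK_tendsto (hα0 : 0 < α) (hα1 : α < 1) (hθ : 0 < α + θ) :
    Tendsto (fun n => ∫ ω, 1 / (K n ω : ℝ) ∂μ) atTop (𝓝 0) := by
  have hθ1 : -1 < θ := by linarith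
  have hc : 0 < min α (α + θ) := lt_min hα0 hθ
  refine rec_tendsto θ hθ1 (min α (α + θ) / 2) (by positivity) _ (fun _ => 0) 1 ?_ tendsto_const_nhds ?_
  · intro n _; exact integral_nonneg fun ω => by positivity
  intro n hn
  have hp : (0:ℝ) < n + θ := by
    have : (1:ℝ) ≤ n := by exact_mod_cast hn
    linarith
  have hg : ∀ k : ℕ, Continuous fun _ : ℝ => (1 / (k : ℝ)) := fun k => continuous_const
  obtain ⟨h1, h2⟩ := markov2 hEP hθ1 1 n le_rfl hn (fun _ k => (1 / (k : ℝ))) hg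
  rw [h2]
  simp only [sub_self, smul_zero, Finset.sum_const_zero, add_zero] at h1 ⊢
  have hi := int_0 hEP 1 n hn (fun _ k => (1 / (k : ℝ))) hg
  have : ∫ ω, (α * (K n ω : ℝ) + θ) • (1 / ((K n ω + 1 : ℕ) : ℝ) - 1 / (K n ω : ℝ)) ∂μ ≤
      ∫ ω, (-(min α (α + θ) / 2)) * (1 / (K n ω : ℝ)) ∂μ := by
    refine integral_mono_ae h1 (hi.const_mul _) ?_
    filter_upwards [ae_basic hEP n hn] with ω ⟨hk, _⟩
    have hk : (1:ℝ) ≤ K n ω := by exact_mod_cast hk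
    generalize (K n ω : ℕ) = k at hk
    have hk0 : (0:ℝ) < k := by linarith
    have e : (1 / ((k + 1 : ℕ) : ℝ) - 1 / (k : ℝ)) = - (1 / (k + 1)) * (1 / (k : ℝ)) := by
      push_cast; field_simp; ring
    rw [e, smul_eq_mul, ← mul_assoc]
    refine mul_le_mul_of_nonneg_right ?_ (by positivity)
    have : min α (α + θ) / 2 ≤ (α * k + θ) * (1 / (k + 1)) := by
      rw [mul_one_div, le_div_iff₀ (by positivity)]
      have ha := min_le_left α (α + θ)
      have hb := min_le_right α (α + θ)
      nlinarith
    linarith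
  rw [integral_const_mul] at this
  rw [smul_eq_mul]
  have h3 := mul_le_mul_of_nonneg_left this (by positivity : 0 ≤ 1 / ((n : ℝ) + θ))
  calc _ ≤ _ := add_le_add le_rfl h3
    _ = _ := by ring

end
end

section
section
variable {α θ : ℝ} {Ω : Type*} {mΩ : MeasurableSpace Ω}
    {μ : Measure Ω} {F : Filtration ℕ mΩ} {K : ℕ → Ω → ℕ} {B : ℕ → ℕ → Ω → ℕ}

variable (hEP : IsEwensPitman α θ μ F K B)
include hEP

lemma sq_bdd (hα0 : 0 < α) (hα1 : α < 1) (hθ : 0 < α + θ) (r : ℕ) (hr : 1 ≤ r) :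
    ∃ M N : ℕ, ∀ n, N ≤ n → ∫ ω, Tn α r K B n ω ^ 2 / (K n ω : ℝ) ∂μ ≤ M := by
  have := hEP.prob
  have hθ1 : -1 < θ := by linarith
  have hr' : (1:ℝ) ≤ r := by exact_mod_cast hr
  set c0 := cc α r 0 with hc0
  set C : ℝ := 2 * |θ| * |c0| * C0 α r + (α + |θ|) * c0 ^ 2 + ∑ i ∈ Finset.Icc 1 r, ((i:ℝ) - α) * cc α r i ^ 2
    with hC
  refine rec_bdd θ hθ1 (2 * ((r:ℝ) - α)) C (by linarith) _ 1 ?_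
  intro n hn
  have hp : (0:ℝ) < n + θ := by
    have : (1:ℝ) ≤ n := by exact_mod_cast hn
    linarith
  have hg : ∀ k : ℕ, Continuous fun x : ℝ => x ^ 2 / (k : ℝ) := fun k => by fun_prop
  obtain ⟨h1, h2⟩ := markov2 hEP hθ1 r n hr hn (fun x k => (x ^ 2 / (k : ℝ))) hg
  rw [h2]
  have hi := int_0 hEP r n hn (fun x k => (x ^ 2 / (k : ℝ))) hg
  have key := integral_mono_ae h1 ((hi.const_mul (-(2 * ((r:ℝ) - α)))).add (integrable_const C)) (by
    filter_upwards [ae_basic hEP n hn] with ω ⟨hk, _, hB, _⟩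
    have hT := T_bound (α := α) r n ω hB
    have hD := drift (α := α) (θ := θ) (K := K) (B := B) r n ω
    have hk : (1:ℝ) ≤ K n ω := by exact_mod_cast hk
    have hB' : ∀ i ∈ Finset.Icc 1 r, (B i n ω : ℝ) ≤ K n ω := fun i hi => by
      exact_mod_cast hB i (Finset.mem_Icc.1 hi).1
    simp only [Pi.add_apply, smul_eq_mul]
    rw [← hc0] at hD ⊢
    push_cast
    generalize Tn α r K B n ω = T at *
    generalize (K n ω : ℝ) = k at *
    have hk0 : (0:ℝ) < k := by linarith
    have ha : 0 ≤ α * k + θ := by nlinarith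
    have s1 : (α * k + θ) * ((T + c0) ^ 2 / (k + 1) - T ^ 2 / k) ≤
        (α * k + θ) * ((2 * T * c0 + c0 ^ 2) / k) := by
      refine mul_le_mul_of_nonneg_left ?_ ha
      have : (T + c0) ^ 2 / (k + 1) ≤ (T + c0) ^ 2 / k :=
        div_le_div_of_nonneg_left (sq_nonneg _) hk0 (by linarith)
      calc _ ≤ (T + c0) ^ 2 / k - T ^ 2 / k := by linarith
        _ = _ := by ring
    have s2 : ∑ i ∈ Finset.Icc 1 r, ((i:ℝ) - α) * (B i n ω : ℝ) * ((T + cc α r i) ^ 2 / k - T ^ 2 / k)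
        = 2 * T / k * ∑ i ∈ Finset.Icc 1 r, ((i:ℝ) - α) * (B i n ω : ℝ) * cc α r i +
          ∑ i ∈ Finset.Icc 1 r, ((i:ℝ) - α) * ((B i n ω : ℝ) / k) * cc α r i ^ 2 := by
      rw [Finset.mul_sum, ← Finset.sum_add_distrib]
      refine Finset.sum_congr rfl fun i _ => by ring
    have s3 : ∑ i ∈ Finset.Icc 1 r, ((i:ℝ) - α) * ((B i n ω : ℝ) / k) * cc α r i ^ 2 ≤
        ∑ i ∈ Finset.Icc 1 r, ((i:ℝ) - α) * cc α r i ^ 2 := by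
      refine Finset.sum_le_sum fun i hi => mul_le_mul_of_nonneg_right ?_ (sq_nonneg _)
      have : (1:ℝ) ≤ i := by exact_mod_cast (Finset.mem_Icc.1 hi).1
      have : (B i n ω : ℝ) / k ≤ 1 := (div_le_one hk0).2 (hB' i hi)
      nlinarith
    rw [s2]
    set S := ∑ i ∈ Finset.Icc 1 r, ((i:ℝ) - α) * (B i n ω : ℝ) * cc α r i
    have s4 : (α * k + θ) * ((2 * T * c0 + c0 ^ 2) / k) + 2 * T / k * S =
        - (2 * ((r:ℝ) - α)) * (T ^ 2 / k) + 2 * θ * c0 * (T / k) + (α + θ / k) * c0 ^ 2 := by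
      have : S = -((r:ℝ) - α) * T + θ * c0 - (α * k + θ) * c0 := by linarith
      rw [this]; field_simp; ring
    have s5 : 2 * θ * c0 * (T / k) ≤ 2 * |θ| * |c0| * C0 α r := by
      refine (le_abs_self _).trans ?_
      rw [abs_mul, abs_mul, abs_mul, abs_two, abs_div, abs_of_pos hk0]
      refine mul_le_mul_of_nonneg_left ?_ (by positivity)
      rw [div_le_iff₀ hk0]; exact hT
    have s6 : (α + θ / k) * c0 ^ 2 ≤ (α + |θ|) * c0 ^ 2 := by
      refine mul_le_mul_of_nonneg_right ?_ (sq_nonneg _)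
      have : θ / k ≤ |θ| := by
        refine (le_abs_self _).trans ?_
        rw [abs_div, abs_of_pos hk0]
        exact div_le_self (abs_nonneg _) hk
      linarith
    rw [hC]
    linarith)
  simp only [Pi.add_apply] at key
  rw [integral_add (hi.const_mul _) (integrable_const C), integral_const_mul, integral_const,
    probReal_univ, one_smul] at key
  rw [smul_eq_mul]
  have h3 := mul_le_mul_of_nonneg_left key (by positivity : 0 ≤ 1 / ((n : ℝ) + θ))
  calc _ ≤ _ := add_le_add le_rfl h3
    _ = _ := by ring

end
end

section

lemma seq_cs (x e : ℕ → ℝ) (M : ℝ) (N : ℕ) (hx : ∀ n, 0 ≤ x n) (he : ∀ n, 0 ≤ e n)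
    (hxe : ∀ n, N ≤ n → ∀ a : ℝ, 0 < a → x n ≤ (a * M + (1 / a) * e n) / 2)
    (h : Tendsto e atTop (𝓝 0)) : Tendsto x atTop (𝓝 0) := by
  have hs : Tendsto (fun n => √(e n)) atTop (𝓝 0) := by
    simpa using h.sqrt
  have ha : Tendsto (fun n : ℕ => √(e n) + 1 / ((n:ℝ) + 1)) atTop (𝓝 0) := by
    simpa using hs.add tendsto_one_div_add_atTop_nhds_zero_nat
  have hb : Tendsto (fun n : ℕ => ((√(e n) + 1 / ((n:ℝ) + 1)) * M + √(e n)) / 2) atTop (𝓝 0) := by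
    simpa using ((ha.mul_const M).add hs).div_const 2
  refine tendsto_of_tendsto_of_tendsto_of_le_of_le' tendsto_const_nhds hb
    (Eventually.of_forall hx) ?_
  filter_upwards [eventually_ge_atTop N] with n hn
  have hp : 0 < √(e n) + 1 / ((n:ℝ) + 1) := by positivity
  refine (hxe n hn _ hp).trans ?_
  have : (1 / (√(e n) + 1 / ((n:ℝ) + 1))) * e n ≤ √(e n) := by
    rw [one_div_mul_eq_div, div_le_iff₀ hp]
    have := Real.mul_self_sqrt (he n)
    have : 0 ≤ √(e n) * (1 / ((n:ℝ) + 1)) := by positivity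
    nlinarith
  linarith

section
variable {α θ : ℝ} {Ω : Type*} {mΩ : MeasurableSpace Ω}
    {μ : Measure Ω} {F : Filtration ℕ mΩ} {K : ℕ → Ω → ℕ} {B : ℕ → ℕ → Ω → ℕ}

variable (hEP : IsEwensPitman α θ μ F K B)
include hEP

lemma int_invK (n : ℕ) (hn : 1 ≤ n) : Integrable (fun ω => 1 / (K n ω : ℝ)) μ :=
  int_0 hEP 1 n hn (fun _ k => 1 / (k:ℝ)) (fun _ => by fun_prop)

lemma int_invsK (n : ℕ) (hn : 1 ≤ n) : Integrable (fun ω => 1 / √(K n ω : ℝ)) μ :=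
  int_0 hEP 1 n hn (fun _ k => 1 / √(k:ℝ)) (fun _ => by fun_prop)

lemma int_T2 (r n : ℕ) (hn : 1 ≤ n) : Integrable (fun ω => Tn α r K B n ω ^ 2 / (K n ω : ℝ)) μ :=
  int_0 hEP r n hn (fun x k => x ^ 2 / (k:ℝ)) (fun _ => by fun_prop)

lemma int_T1 (r n : ℕ) (hn : 1 ≤ n) : Integrable (fun ω => |Tn α r K B n ω| / (K n ω : ℝ)) μ :=
  int_0 hEP r n hn (fun x k => |x| / (k:ℝ)) (fun _ => by fun_prop)

lemma int_B (p : ℝ) (i n : ℕ) (hi : 1 ≤ i) (hn : 1 ≤ n) :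
    Integrable (fun ω => |(B i n ω : ℝ) / (K n ω : ℝ) - p|) μ := by
  have := hEP.prob
  have h1 : Measurable (fun ω => (K n ω : ℝ)) := measurable_from_top.comp (meas_K' hEP n)
  have h2 : Measurable (fun ω => (B i n ω : ℝ)) := measurable_from_top.comp (meas_B' hEP i n)
  refine Integrable.abs (Integrable.sub ?_ (integrable_const p))
  refine Integrable.of_bound (h2.div h1).aestronglyMeasurable 1 ?_
  filter_upwards [ae_basic hEP n hn] with ω ⟨hk, _, hB, _⟩
  have hk : (1:ℝ) ≤ K n ω := by exact_mod_cast hk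
  have hB' : (B i n ω : ℝ) ≤ K n ω := by exact_mod_cast hB i hi
  rw [Real.norm_of_nonneg (by positivity)]
  exact (div_le_one (by linarith)).2 hB'

lemma invs_tendsto (hα0 : 0 < α) (hα1 : α < 1) (hθ : 0 < α + θ) :
    Tendsto (fun n => ∫ ω, 1 / √(K n ω : ℝ) ∂μ) atTop (𝓝 0) := by
  have := hEP.prob
  refine seq_cs _ _ 1 1 (fun n => integral_nonneg fun ω => by positivity)
    (fun n => integral_nonneg fun ω => by positivity) ?_ (invK_tendsto hEP hα0 hα1 hθ)
  intro n hn a ha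
  have i1 := int_invK hEP n hn
  have : ∫ ω, 1 / √(K n ω : ℝ) ∂μ ≤ ∫ ω, (a / 2 + (1 / (2 * a)) * (1 / (K n ω : ℝ))) ∂μ := by
    refine integral_mono_ae (int_invsK hEP n hn) ((integrable_const _).add (i1.const_mul _)) ?_
    filter_upwards with ω
    have e : 1 / (K n ω : ℝ) = (1 / √(K n ω : ℝ)) ^ 2 := by
      rw [div_pow, Real.sq_sqrt (by positivity), one_pow]
    simp only [e]
    generalize 1 / √(K n ω : ℝ) = y
    have : a / 2 + 1 / (2 * a) * y ^ 2 - y = (a - y) ^ 2 / (2 * a) := by field_simp; ring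
    have : 0 ≤ (a - y) ^ 2 / (2 * a) := by positivity
    linarith
  rw [integral_add (integrable_const _) (i1.const_mul _), integral_const_mul, integral_const,
    probReal_univ, one_smul] at this
  calc _ ≤ _ := this
    _ = _ := by field_simp

lemma absT_tendsto (hα0 : 0 < α) (hα1 : α < 1) (hθ : 0 < α + θ) (r : ℕ) (hr : 1 ≤ r) :
    Tendsto (fun n => ∫ ω, |Tn α r K B n ω| / (K n ω : ℝ) ∂μ) atTop (𝓝 0) := by
  have := hEP.prob
  obtain ⟨M, N, hMN⟩ := sq_bdd hEP hα0 hα1 hθ r hr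
  refine seq_cs _ _ M (max 1 N) (fun n => integral_nonneg fun ω => by positivity)
    (fun n => integral_nonneg fun ω => by positivity) ?_ (invK_tendsto hEP hα0 hα1 hθ)
  intro n hn a ha
  have hn1 : 1 ≤ n := (le_max_left _ _).trans hn
  have i1 := int_invK hEP n hn1
  have i2 := int_T2 hEP r n hn1
  have : ∫ ω, |Tn α r K B n ω| / (K n ω : ℝ) ∂μ ≤
      ∫ ω, (a / 2 * (Tn α r K B n ω ^ 2 / (K n ω : ℝ)) + (1 / (2 * a)) * (1 / (K n ω : ℝ))) ∂μ := by
    refine integral_mono_ae (int_T1 hEP r n hn1) ((i2.const_mul _).add (i1.const_mul _)) ?_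
    filter_upwards with ω
    have e : 0 ≤ 1 / (K n ω : ℝ) := by positivity
    rw [div_eq_mul_one_div, div_eq_mul_one_div (Tn α r K B n ω ^ 2), ← sq_abs (Tn α r K B n ω)]
    generalize 1 / (K n ω : ℝ) = y at *
    generalize |Tn α r K B n ω| = t at *
    have : a / 2 * (t ^ 2 * y) + 1 / (2 * a) * y - t * y = (a * t - 1) ^ 2 / (2 * a) * y := by field_simp; ring
    have : 0 ≤ (a * t - 1) ^ 2 / (2 * a) * y := by positivity
    linarith
  rw [integral_add (i2.const_mul _) (i1.const_mul _), integral_const_mul, integral_const_mul] at this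
  have h2 := mul_le_mul_of_nonneg_left (hMN n ((le_max_right _ _).trans hn)) (by positivity : 0 ≤ a / 2)
  calc _ ≤ _ := this
    _ ≤ a / 2 * M + 1 / (2 * a) * ∫ ω, 1 / (K n ω : ℝ) ∂μ := by linarith
    _ = _ := by field_simp

lemma B_tendsto (hα0 : 0 < α) (hα1 : α < 1) (hθ : 0 < α + θ) (j : ℕ) : 1 ≤ j →
    Tendsto (fun n => ∫ ω, |(B j n ω : ℝ) / (K n ω : ℝ) - sibuya α j| ∂μ) atTop (𝓝 0) := by
  induction j using Nat.strong_induction_on with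
  | _ j ih =>
  intro hj
  have hb : Tendsto (fun n => ∫ ω, |Tn α j K B n ω| / (K n ω : ℝ) ∂μ +
      ∑ i ∈ Finset.Ico 1 j, |bCoef α j i| * ∫ ω, |(B i n ω : ℝ) / (K n ω : ℝ) - sibuya α i| ∂μ)
      atTop (𝓝 0) := by
    have := (absT_tendsto hEP hα0 hα1 hθ j hj).add (tendsto_finsetSum (Finset.Ico 1 j) fun i hi =>
      (ih i (Finset.mem_Ico.1 hi).2 (Finset.mem_Ico.1 hi).1).const_mul (|bCoef α j i|))
    simpa using this
  refine tendsto_of_tendsto_of_tendsto_of_le_of_le' tendsto_const_nhds hb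
    (Eventually.of_forall fun n => integral_nonneg fun ω => abs_nonneg _) ?_
  filter_upwards [eventually_ge_atTop 1] with n hn
  have i1 := int_T1 hEP j n hn
  have i2 : ∀ i ∈ Finset.Ico 1 j, Integrable (fun ω => |bCoef α j i| * |(B i n ω : ℝ) / (K n ω : ℝ) - sibuya α i|) μ :=
    fun i hi => (int_B hEP _ i n (Finset.mem_Ico.1 hi).1 hn).const_mul _
  have : ∫ ω, |(B j n ω : ℝ) / (K n ω : ℝ) - sibuya α j| ∂μ ≤ ∫ ω, (|Tn α j K B n ω| / (K n ω : ℝ) +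
      ∑ i ∈ Finset.Ico 1 j, |bCoef α j i| * |(B i n ω : ℝ) / (K n ω : ℝ) - sibuya α i|) ∂μ := by
    refine integral_mono_ae (int_B hEP _ j n hj hn) (i1.add (integrable_finsetSum _ i2)) ?_
    filter_upwards [ae_basic hEP n hn] with ω ⟨hk, _, hB, _⟩
    have hk : (1:ℝ) ≤ K n ω := by exact_mod_cast hk
    have hk0 : (0:ℝ) < K n ω := by linarith
    have hs := sum_bCoef_sibuya α j hj
    have hsplit : ∀ f : ℕ → ℝ, ∑ i ∈ Finset.Icc 1 j, f i = ∑ i ∈ Finset.Ico 1 j, f i + f j := by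
      intro f
      rw [← Finset.sum_Ico_succ_top hj, Finset.Ico_add_one_right_eq_Icc]
    have e : (B j n ω : ℝ) / (K n ω : ℝ) - sibuya α j = Tn α j K B n ω / (K n ω : ℝ) -
        ∑ i ∈ Finset.Ico 1 j, bCoef α j i * ((B i n ω : ℝ) / (K n ω : ℝ) - sibuya α i) := by
      rw [Tn, ← hs, hsplit, hsplit, bCoef_self]
      simp only [mul_sub, Finset.sum_sub_distrib, ← mul_div_assoc, ← Finset.sum_div]
      field_simp
      ring
    rw [e]
    refine (abs_sub _ _).trans ?_
    rw [abs_div, abs_of_pos hk0]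
    refine add_le_add le_rfl ((Finset.abs_sum_le_sum_abs _ _).trans ?_)
    exact Finset.sum_le_sum fun i _ => (abs_mul _ _).le
  rw [integral_add i1 (integrable_finsetSum _ i2), integral_finsetSum _ i2] at this
  simpa only [integral_const_mul] using this

def Rn (α : ℝ) (r : ℕ) {Ω : Type*} (K : ℕ → Ω → ℕ) (B : ℕ → ℕ → Ω → ℕ) (n : ℕ) (ω : Ω) : ℝ :=
  1 / √(K n ω : ℝ) + |Tn α r K B n ω| / (K n ω : ℝ) +
    ∑ i ∈ Finset.Icc 1 r, |(B i n ω : ℝ) / (K n ω : ℝ) - sibuya α i|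

lemma int_R (r n : ℕ) (hn : 1 ≤ n) : Integrable (Rn α r K B n) μ :=
  ((int_invsK hEP n hn).add (int_T1 hEP r n hn)).add
    (integrable_finsetSum _ fun i hi => int_B hEP _ i n (Finset.mem_Icc.1 hi).1 hn)

lemma R_tendsto (hα0 : 0 < α) (hα1 : α < 1) (hθ : 0 < α + θ) (r : ℕ) (hr : 1 ≤ r) :
    Tendsto (fun n => ∫ ω, Rn α r K B n ω ∂μ) atTop (𝓝 0) := by
  have h := ((invs_tendsto hEP hα0 hα1 hθ).add (absT_tendsto hEP hα0 hα1 hθ r hr)).add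
    (tendsto_finsetSum (Finset.Icc 1 r) fun i hi =>
      (B_tendsto hEP hα0 hα1 hθ i (Finset.mem_Icc.1 hi).1))
  simp only [add_zero, Finset.sum_const_zero] at h
  refine h.congr' ?_
  filter_upwards [eventually_ge_atTop 1] with n hn
  have i3 : ∀ i ∈ Finset.Icc 1 r, Integrable (fun ω => |(B i n ω : ℝ) / (K n ω : ℝ) - sibuya α i|) μ :=
    fun i hi => int_B hEP _ i n (Finset.mem_Icc.1 hi).1 hn
  have i12 : Integrable (fun ω => 1 / √(K n ω : ℝ) + |Tn α r K B n ω| / (K n ω : ℝ)) μ :=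
    (int_invsK hEP n hn).add (int_T1 hEP r n hn)
  unfold Rn
  rw [integral_add i12 (integrable_finsetSum _ i3),
    integral_add (int_invsK hEP n hn) (int_T1 hEP r n hn), integral_finsetSum _ i3]

end
end

section

lemma gauss_step (σ2 lam A s t : ℝ) (hσ : 0 ≤ σ2) (hl : 0 < lam) (hs : 0 ≤ s) (hA : 0 ≤ A)
    (ht : |t| ≤ A) (h1 : lam * s ≤ 1) (h2 : A ^ 2 * lam * σ2 * s ≤ 1) :
    |Real.exp (-(σ2 * t ^ 2 / 2)) - (1 - t ^ 2 * lam * σ2 * s) *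
      Real.exp (-(σ2 * ((1 - lam * s) * t) ^ 2 / 2))| ≤
      s * |t| * (s * (A * lam * σ2 * (A ^ 2 * lam * σ2 + lam / 2))) := by
  set y := t ^ 2 * lam * σ2 * s with hy
  have hy0 : 0 ≤ y := by positivity
  have htA : t ^ 2 ≤ A ^ 2 := by
    rw [← sq_abs]; exact pow_le_pow_left₀ (abs_nonneg _) ht 2
  have hy1 : y ≤ A ^ 2 * lam * σ2 * s := by rw [hy]; gcongr
  set w := -y + y * (lam * s) / 2 with hw
  have hls : 0 ≤ lam * s := by positivity
  have hyl : y * (lam * s) ≤ y := mul_le_of_le_one_right hy0 h1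
  have hyl0 : 0 ≤ y * (lam * s) := by positivity
  have hw1 : |w| ≤ y := by rw [abs_le]; constructor <;> linarith
  have e : Real.exp (-(σ2 * t ^ 2 / 2)) =
      Real.exp w * Real.exp (-(σ2 * ((1 - lam * s) * t) ^ 2 / 2)) := by
    rw [← Real.exp_add]; congr 1; rw [hw, hy]; ring
  rw [e, ← sub_mul, abs_mul, abs_of_pos (Real.exp_pos _)]
  have hE : Real.exp (-(σ2 * ((1 - lam * s) * t) ^ 2 / 2)) ≤ 1 := by
    rw [Real.exp_le_one_iff]
    have : 0 ≤ σ2 * ((1 - lam * s) * t) ^ 2 / 2 := by positivity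
    linarith
  have h3 : |Real.exp w - (1 - y)| ≤ y ^ 2 + y * (lam * s) / 2 := by
    have h4 := Real.abs_exp_sub_one_sub_id_le (x := w) (by linarith)
    have h5 : w ^ 2 ≤ y ^ 2 := by rw [← sq_abs w]; exact pow_le_pow_left₀ (abs_nonneg _) hw1 2
    have e2 : Real.exp w - (1 - y) = (Real.exp w - 1 - w) + y * (lam * s) / 2 := by rw [hw]; ring
    rw [e2]
    refine (abs_add_le _ _).trans ?_
    rw [abs_of_nonneg (by positivity : 0 ≤ y * (lam * s) / 2)]
    linarith
  calc _ ≤ (y ^ 2 + y * (lam * s) / 2) * 1 := mul_le_mul h3 hE (Real.exp_pos _).le (by positivity)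
    _ = y * (y + lam * s / 2) := by ring
    _ ≤ (A * |t| * lam * σ2 * s) * (A ^ 2 * lam * σ2 * s + lam * s / 2) := by
      have : y ≤ A * |t| * lam * σ2 * s := by
        rw [hy, ← sq_abs, sq]; gcongr
      gcongr
    _ = _ := by ring

lemma char_rec (θ : ℝ) (hθ : -1 < θ) (lam σ2 A : ℝ) (hl : 0 < lam) (hσ : 0 ≤ σ2) (hA : 0 ≤ A)
    (φ : ℕ → ℝ → ℂ) (δ : ℕ → ℝ) (hδ : Tendsto δ atTop (𝓝 0)) (hδ0 : ∀ n, 0 ≤ δ n) (N : ℕ)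
    (hrec : ∀ n, N ≤ n → ∀ t, |t| ≤ A → ‖φ (n+1) t - ((1 - t ^ 2 * lam * σ2 * (1 / ((n:ℝ) + θ)) : ℝ) : ℂ) *
      φ n ((1 - lam * (1 / ((n:ℝ) + θ))) * t)‖ ≤ 1 / ((n:ℝ) + θ) * |t| * δ n)
    (hbase : ∀ n, N ≤ n → ∃ X, 0 ≤ X ∧ ∀ t, ‖φ n t - 1‖ ≤ X * |t|) (t : ℝ) (ht : |t| ≤ A) :
    Tendsto (fun n => φ n t) atTop (𝓝 ((Real.exp (-(σ2 * t ^ 2 / 2)) : ℝ) : ℂ)) := by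
  have hs : Tendsto (fun n : ℕ => 1 / ((n:ℝ) + θ)) atTop (𝓝 0) := by
    have := tendsto_atTop_add_const_right atTop θ (tendsto_natCast_atTop_atTop (R := ℝ))
    simp only [one_div]
    exact this.inv_tendsto_atTop
  have hs1 : ∀ᶠ n : ℕ in atTop, lam * (1 / ((n:ℝ) + θ)) < 1 := by
    have := hs.const_mul lam
    rw [mul_zero] at this
    exact this.eventually_lt_const one_pos
  have hs2 : ∀ᶠ n : ℕ in atTop, A ^ 2 * lam * σ2 * (1 / ((n:ℝ) + θ)) < 1 := by
    have := hs.const_mul (A ^ 2 * lam * σ2)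
    rw [mul_zero] at this
    exact this.eventually_lt_const one_pos
  obtain ⟨N1, hN1⟩ := eventually_atTop.1 (hs1.and (hs2.and (eventually_ge_atTop (max N 1))))
  set G : ℝ := A * lam * σ2 * (A ^ 2 * lam * σ2 + lam / 2) with hG
  have hG0 : 0 ≤ G := by positivity
  have hp : ∀ n, N1 ≤ n → 0 < (n:ℝ) + θ := fun n hn => by
    have : 1 ≤ n := (le_max_right _ _).trans (hN1 n hn).2.2
    have : (1:ℝ) ≤ n := by exact_mod_cast this
    linarith
  obtain ⟨X, hX0, hX⟩ := hbase N1 ((le_max_left _ _).trans (hN1 N1 le_rfl).2.2)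
  set ε : ℕ → ℝ := fun n => δ n + 1 / ((n:ℝ) + θ) * G with hε
  have hεt : Tendsto ε atTop (𝓝 0) := by
    have := hδ.add (hs.mul_const G)
    rw [zero_mul, add_zero] at this
    exact this
  let x : ℕ → ℝ := fun n => Nat.rec (X + σ2 * A / 2) (fun n y => if n < N1 then X + σ2 * A / 2 else
    (1 - lam / ((n:ℝ) + θ)) * y + ε n / ((n:ℝ) + θ)) n
  have hxs : ∀ n, x (n+1) = if n < N1 then X + σ2 * A / 2 else
    (1 - lam / ((n:ℝ) + θ)) * x n + ε n / ((n:ℝ) + θ) := fun n => rfl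
  have hxN : x N1 = X + σ2 * A / 2 := by
    cases N1 with
    | zero => rfl
    | succ m => rw [hxs, if_pos (Nat.lt_succ_self m)]
  have hxstep : ∀ n, N1 ≤ n → x (n+1) = (1 - lam / ((n:ℝ) + θ)) * x n + ε n / ((n:ℝ) + θ) :=
    fun n hn => by rw [hxs, if_neg (by omega)]
  have hx0 : ∀ n, N1 ≤ n → 0 ≤ x n := by
    intro n hn
    induction n, hn using Nat.le_induction with
    | base => rw [hxN]; positivity
    | succ n hn ih =>
      rw [hxstep n hn]
      have := hp n hn
      have h1 := (hN1 n hn).1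
      have h2 := hδ0 n
      have : 0 ≤ ε n := by simp only [hε]; positivity
      have : 0 ≤ 1 - lam / ((n:ℝ) + θ) := by rw [div_eq_mul_one_div]; linarith
      positivity
  have hxt : Tendsto x atTop (𝓝 0) := rec_tendsto θ hθ lam hl x ε N1 hx0 hεt fun n hn => (hxstep n hn).le
  have main : ∀ n, N1 ≤ n → ∀ t, |t| ≤ A → ‖φ n t - ((Real.exp (-(σ2 * t ^ 2 / 2)) : ℝ) : ℂ)‖ ≤ x n * |t| := by
    intro n hn
    induction n, hn using Nat.le_induction with
    | base =>
      intro t ht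
      have h1 := hX t
      have h2 : ‖(1:ℂ) - ((Real.exp (-(σ2 * t ^ 2 / 2)) : ℝ) : ℂ)‖ ≤ σ2 * A / 2 * |t| := by
        rw [← Complex.ofReal_one, ← Complex.ofReal_sub, Complex.norm_real, Real.norm_eq_abs]
        have hn0 : 0 ≤ σ2 * t ^ 2 / 2 := by positivity
        have h3 : Real.exp (-(σ2 * t ^ 2 / 2)) ≤ 1 := by rw [Real.exp_le_one_iff]; linarith
        rw [abs_of_nonneg (by linarith)]
        have h4 := Real.add_one_le_exp (-(σ2 * t ^ 2 / 2))
        calc _ ≤ σ2 * t ^ 2 / 2 := by linarith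
          _ = σ2 * (|t| * |t|) / 2 := by rw [← sq, sq_abs]
          _ ≤ σ2 * (A * |t|) / 2 := by gcongr
          _ = _ := by ring
      calc _ = ‖(φ N1 t - 1) + (1 - ((Real.exp (-(σ2 * t ^ 2 / 2)) : ℝ) : ℂ))‖ := by congr 1; ring
        _ ≤ _ := norm_add_le _ _
        _ ≤ X * |t| + σ2 * A / 2 * |t| := add_le_add h1 h2
        _ = _ := by rw [hxN]; ring
    | succ n hn ih =>
      intro t ht
      have hpn := hp n hn
      obtain ⟨h1, h2, h3⟩ := hN1 n hn
      have r1 := hrec n ((le_max_left _ _).trans h3) t ht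
      rw [hxstep n hn]
      have es : lam / ((n:ℝ) + θ) = lam * (1 / ((n:ℝ) + θ)) := by ring
      have ee : ε n / ((n:ℝ) + θ) = (1 / ((n:ℝ) + θ)) * (δ n + 1 / ((n:ℝ) + θ) * G) := by
        simp only [hε]; ring
      rw [es, ee]
      have hs0 : 0 ≤ 1 / ((n:ℝ) + θ) := by positivity
      generalize 1 / ((n:ℝ) + θ) = s at *
      have r2 := gauss_step σ2 lam A s t hσ hl hs0 hA ht h1.le h2.le
      rw [← hG] at r2
      have hu0 : 0 ≤ 1 - lam * s := by linarith
      have hu1 : 1 - lam * s ≤ 1 := by nlinarith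
      have hut : |(1 - lam * s) * t| = (1 - lam * s) * |t| := by rw [abs_mul, abs_of_nonneg hu0]
      have hut2 : |(1 - lam * s) * t| ≤ A := by
        rw [hut]; exact (mul_le_of_le_one_left (abs_nonneg _) hu1).trans ht
      have r3 := ih ((1 - lam * s) * t) hut2
      rw [hut] at r3
      have htA : t ^ 2 ≤ A ^ 2 := by
        rw [← sq_abs]; exact pow_le_pow_left₀ (abs_nonneg _) ht 2
      have hy1 : t ^ 2 * lam * σ2 * s ≤ 1 := le_trans (by gcongr) h2.le
      have hy0 : 0 ≤ t ^ 2 * lam * σ2 * s := by positivity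
      have r4 : ‖((1 - t ^ 2 * lam * σ2 * s : ℝ) : ℂ)‖ ≤ 1 := by
        rw [Complex.norm_real, Real.norm_eq_abs, abs_of_nonneg (by linarith)]; linarith
      generalize (1 - lam * s) * t = ut at *
      generalize 1 - t ^ 2 * lam * σ2 * s = q at *
      generalize Real.exp (-(σ2 * t ^ 2 / 2)) = γ1 at *
      generalize Real.exp (-(σ2 * ut ^ 2 / 2)) = γ2 at *
      have r5 : ‖(γ1 : ℂ) - (q : ℂ) * (γ2 : ℂ)‖ ≤ s * |t| * (s * G) := by
        rw [← Complex.ofReal_mul, ← Complex.ofReal_sub, Complex.norm_real, Real.norm_eq_abs]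
        exact r2
      have r6 : ‖(q : ℂ) * (φ n ut - (γ2 : ℂ))‖ ≤ x n * ((1 - lam * s) * |t|) := by
        rw [norm_mul]
        exact (mul_le_of_le_one_left (norm_nonneg _) r4).trans r3
      calc _ = ‖(φ (n+1) t - (q:ℂ) * φ n ut) + (q : ℂ) * (φ n ut - (γ2 : ℂ)) - ((γ1 : ℂ) - (q : ℂ) * (γ2 : ℂ))‖ := by
            congr 1; ring
        _ ≤ s * |t| * δ n + x n * ((1 - lam * s) * |t|) + s * |t| * (s * G) :=
            (norm_sub_le _ _).trans (add_le_add ((norm_add_le _ _).trans (add_le_add r1 r6)) r5)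
        _ = _ := by ring
  rw [tendsto_iff_norm_sub_tendsto_zero]
  refine tendsto_of_tendsto_of_tendsto_of_le_of_le' tendsto_const_nhds
    (by simpa using hxt.mul_const (|t|)) (Eventually.of_forall fun n => norm_nonneg _) ?_
  filter_upwards [eventually_ge_atTop N1] with n hn
  exact main n hn t ht

end

section
section
variable {α θ : ℝ} {Ω : Type*} {mΩ : MeasurableSpace Ω}
    {μ : Measure Ω} {F : Filtration ℕ mΩ} {K : ℕ → Ω → ℕ} {B : ℕ → ℕ → Ω → ℕ}

def Zn (α : ℝ) (r : ℕ) {Ω : Type*} (K : ℕ → Ω → ℕ) (B : ℕ → ℕ → Ω → ℕ) (n : ℕ) (ω : Ω) : ℝ :=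
  Tn α r K B n ω / √(K n ω : ℝ)

def ph (α : ℝ) (r : ℕ) {Ω : Type*} {mΩ : MeasurableSpace Ω} (μ : Measure Ω)
    (K : ℕ → Ω → ℕ) (B : ℕ → ℕ → Ω → ℕ) (n : ℕ) (t : ℝ) : ℂ :=
  ∫ ω, Complex.exp (Complex.I * ((t * Zn α r K B n ω : ℝ) : ℂ)) ∂μ

lemma norm_expI (x : ℝ) : ‖Complex.exp (Complex.I * (x : ℂ))‖ = 1 := by
  rw [mul_comm]; exact Complex.norm_exp_ofReal_mul_I x

lemma Zsq (r n : ℕ) (ω : Ω) : Zn α r K B n ω ^ 2 = Tn α r K B n ω ^ 2 / (K n ω : ℝ) := by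
  rw [Zn, div_pow, Real.sq_sqrt (by positivity)]

lemma cont_g (t : ℝ) (k : ℕ) :
    Continuous fun x : ℝ => Complex.exp (Complex.I * ((t * (x / √(k:ℝ)) : ℝ) : ℂ)) := by
  fun_prop

variable (hEP : IsEwensPitman α θ μ F K B)
include hEP

lemma int_e (r n : ℕ) (hn : 1 ≤ n) (t : ℝ) :
    Integrable (fun ω => Complex.exp (Complex.I * ((t * Zn α r K B n ω : ℝ) : ℂ))) μ :=
  int_0 hEP r n hn (fun x k => Complex.exp (Complex.I * ((t * (x / √(k:ℝ)) : ℝ) : ℂ)))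
    (cont_g t)

lemma int_Z2 (r n : ℕ) (hn : 1 ≤ n) : Integrable (fun ω => Zn α r K B n ω ^ 2) μ := by
  simp only [Zsq]; exact int_T2 hEP r n hn

lemma int_Zabs (r n : ℕ) (hn : 1 ≤ n) : Integrable (fun ω => |Zn α r K B n ω|) μ :=
  int_0 hEP r n hn (fun x k => |x / √(k:ℝ)|) (fun k => by fun_prop)

lemma int_eZ (r n : ℕ) (hn : 1 ≤ n) (t : ℝ) :
    Integrable (fun ω => Complex.exp (Complex.I * ((t * Zn α r K B n ω : ℝ) : ℂ)) * (Zn α r K B n ω : ℂ)) μ :=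
  int_0 hEP r n hn (fun x k => Complex.exp (Complex.I * ((t * (x / √(k:ℝ)) : ℝ) : ℂ)) * ((x / √(k:ℝ) : ℝ) : ℂ))
    (fun k => by fun_prop)

lemma ph_base (r n : ℕ) (hn : 1 ≤ n) (t : ℝ) :
    ‖ph α r μ K B n t - 1‖ ≤ (∫ ω, |Zn α r K B n ω| ∂μ) * |t| := by
  have := hEP.prob
  have e : ph α r μ K B n t - 1 =
      ∫ ω, (Complex.exp (Complex.I * ((t * Zn α r K B n ω : ℝ) : ℂ)) - 1) ∂μ := by
    rw [integral_sub (int_e hEP r n hn t) (integrable_const _)]; simp [ph]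
  rw [e]
  refine (norm_integral_le_integral_norm _).trans ?_
  rw [← integral_mul_const]
  refine integral_mono ((int_e hEP r n hn t).sub (integrable_const _)).norm
    ((int_Zabs hEP r n hn).mul_const _) fun ω => ?_
  refine (exp_bound1 _).trans ?_
  rw [abs_mul, mul_comm]

lemma ph_step1 (hα0 : 0 < α) (hα1 : α < 1) (hθ : 0 < α + θ) (r : ℕ) (hr : 1 ≤ r) (A : ℝ) (hA : 0 ≤ A)
    (v : ℝ) (hv : v = α * cc α r 0 ^ 2 + ∑ i ∈ Finset.Icc 1 r, ((i:ℝ) - α) * sibuya α i * cc α r i ^ 2) :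
    ∃ C, 0 ≤ C ∧ ∀ n, 1 ≤ n → ∀ t, |t| ≤ A →
    ‖ph α r μ K B (n+1) t - ∫ ω, Complex.exp (Complex.I * ((t * Zn α r K B n ω : ℝ) : ℂ)) *
      (1 - ((1 / ((n:ℝ) + θ) : ℝ) : ℂ) * (Complex.I * ((t * (((r:ℝ) - α / 2) * Zn α r K B n ω) : ℝ) : ℂ)
        + ((t ^ 2 / 2 * v : ℝ) : ℂ))) ∂μ‖ ≤
      1 / ((n:ℝ) + θ) * (C * |t| * ∫ ω, Rn α r K B n ω ∂μ) := by
  have hθ1 : -1 < θ := by linarith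
  obtain ⟨C, hC, hstep⟩ := step_bound α θ ((r:ℝ) - α) (C0 α r) A (cc α r 0) hα0.le hα1.le
    (C0_nonneg α r) hA (cc α r) (sibuya α) r
  refine ⟨C, hC, fun n hn t ht => ?_⟩
  have hp : (0:ℝ) < n + θ := by
    have : (1:ℝ) ≤ n := by exact_mod_cast hn
    linarith
  obtain ⟨h1, h2⟩ := markov2 hEP hθ1 r n hr hn
    (fun x k => Complex.exp (Complex.I * ((t * (x / √(k:ℝ)) : ℝ) : ℂ))) (cont_g t)
  have h2' : ph α r μ K B (n+1) t = _ := h2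
  rw [h2']
  set L := fun ω => (α * (K n ω : ℝ) + θ) •
      (Complex.exp (Complex.I * ((t * ((Tn α r K B n ω + cc α r 0) / √((K n ω + 1 : ℕ):ℝ)) : ℝ) : ℂ))
        - Complex.exp (Complex.I * ((t * (Tn α r K B n ω / √(K n ω:ℝ)) : ℝ) : ℂ))) +
      ∑ i ∈ Finset.Icc 1 r, (((i : ℝ) - α) * (B i n ω : ℝ)) •
        (Complex.exp (Complex.I * ((t * ((Tn α r K B n ω + cc α r i) / √(K n ω:ℝ)) : ℝ) : ℂ))
        - Complex.exp (Complex.I * ((t * (Tn α r K B n ω / √(K n ω:ℝ)) : ℝ) : ℂ))) with hL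
  set s := 1 / ((n:ℝ) + θ) with hs
  have hs0 : 0 ≤ s := by positivity
  set E : Ω → ℂ := fun ω => Complex.exp (Complex.I * ((t * Zn α r K B n ω : ℝ) : ℂ)) with hE
  set Q : Ω → ℂ := fun ω => E ω * (Complex.I * ((t * (((r:ℝ) - α / 2) * Zn α r K B n ω) : ℝ) : ℂ)
        + ((t ^ 2 / 2 * v : ℝ) : ℂ)) with hQ
  have iE : Integrable E μ := int_e hEP r n hn t
  have iQ : Integrable Q μ := by
    have := ((int_eZ hEP r n hn t).const_mul (Complex.I * ((t * ((r:ℝ) - α / 2) : ℝ) : ℂ))).add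
      (iE.mul_const ((t ^ 2 / 2 * v : ℝ) : ℂ))
    refine this.congr (Eventually.of_forall fun ω => ?_)
    simp only [hQ, hE, Pi.add_apply]; push_cast; ring
  have e1 : ∫ ω, E ω * (1 - (s : ℂ) * (Complex.I * ((t * (((r:ℝ) - α / 2) * Zn α r K B n ω) : ℝ) : ℂ)
        + ((t ^ 2 / 2 * v : ℝ) : ℂ))) ∂μ = ∫ ω, E ω ∂μ - s • ∫ ω, Q ω ∂μ := by
    have iQs : Integrable (fun ω => s • Q ω) μ := iQ.smul s
    rw [← integral_smul, ← integral_sub iE iQs]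
    refine integral_congr_ae (Eventually.of_forall fun ω => ?_)
    simp only [hQ, Complex.real_smul]; ring
  rw [e1]
  have e2 : ∫ ω, E ω ∂μ + s • ∫ ω, L ω ∂μ - (∫ ω, E ω ∂μ - s • ∫ ω, Q ω ∂μ) = s • ∫ ω, (L ω + Q ω) ∂μ := by
    rw [integral_add h1 iQ, smul_add]; ring
  have e3 : ‖s • ∫ ω, (L ω + Q ω) ∂μ‖ ≤ s * (C * |t| * ∫ ω, Rn α r K B n ω ∂μ) := by
    rw [norm_smul, Real.norm_of_nonneg hs0]
    refine mul_le_mul_of_nonneg_left ?_ hs0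
    refine (norm_integral_le_integral_norm _).trans ?_
    rw [← integral_const_mul]
    refine integral_mono_ae (h1.add iQ).norm ((int_R hEP r n hn).const_mul _) ?_
    filter_upwards [ae_basic hEP n hn] with ω ⟨hk, _, hB, _⟩
    have hT := T_bound (α := α) r n ω hB
    have hD := drift (α := α) (θ := θ) (K := K) (B := B) r n ω
    have hk : (1:ℝ) ≤ K n ω := by exact_mod_cast hk
    have hk0 : (0:ℝ) ≤ K n ω := by linarith
    have hsq : √(K n ω : ℝ) ^ 2 = K n ω := Real.sq_sqrt hk0
    have hsq1 : √((K n ω + 1 : ℕ) : ℝ) ^ 2 = K n ω + 1 := by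
      rw [Real.sq_sqrt (by positivity)]; push_cast; ring
    have := hstep (√(K n ω : ℝ)) (√((K n ω + 1 : ℕ) : ℝ)) (Tn α r K B n ω) (fun i => (B i n ω : ℝ))
      (Real.one_le_sqrt.2 hk) (Real.sqrt_pos.2 (by positivity)) (by rw [hsq, hsq1])
      (by rw [hsq]; exact hT)
      (fun i hi => ⟨by positivity, by rw [hsq]; exact_mod_cast hB i (Finset.mem_Icc.1 hi).1⟩)
      (by rw [hsq]; exact hD) t ht
    simp only [hsq] at this
    rw [← hv] at this
    have e4 : L ω + Q ω = E ω * (((α*(K n ω : ℝ)+θ:ℝ):ℂ)*(Complex.exp (Complex.I*((t*((Tn α r K B n ω+cc α r 0)/√((K n ω + 1 : ℕ) : ℝ) - Tn α r K B n ω/√(K n ω : ℝ)):ℝ) : ℂ))-1) + ∑ i ∈ Finset.Icc 1 r, ((((i:ℝ)-α)*(B i n ω : ℝ):ℝ) : ℂ)*(Complex.exp (Complex.I*((t*(cc α r i/√(K n ω : ℝ)):ℝ) : ℂ))-1) + (Complex.I*((t*(((r:ℝ)-α+α/2)*(Tn α r K B n ω/√(K n ω : ℝ))):ℝ) : ℂ)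 + ((t^2/2*v:ℝ):ℂ))) := by
      have hE' : E ω = Complex.exp (Complex.I * ((t * (Tn α r K B n ω / √(K n ω:ℝ)) : ℝ) : ℂ)) := rfl
      have f1 : Complex.exp (Complex.I * ((t * ((Tn α r K B n ω + cc α r 0) / √((K n ω + 1 : ℕ):ℝ)) : ℝ) : ℂ))
          = E ω * Complex.exp (Complex.I*((t*((Tn α r K B n ω+cc α r 0)/√((K n ω + 1 : ℕ) : ℝ) - Tn α r K B n ω/√(K n ω : ℝ)):ℝ) : ℂ)) := by
        rw [hE', ← Complex.exp_add]; congr 1; push_cast; ring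
      have f2 : ∀ i, Complex.exp (Complex.I * ((t * ((Tn α r K B n ω + cc α r i) / √(K n ω:ℝ)) : ℝ) : ℂ))
          = E ω * Complex.exp (Complex.I*((t*(cc α r i/√(K n ω : ℝ)):ℝ) : ℂ)) := by
        intro i
        rw [hE', ← Complex.exp_add]; congr 1; push_cast; ring
      have f3 : (r:ℝ) - α / 2 = (r:ℝ) - α + α / 2 := by ring
      simp only [hL, hQ, f1, f2, ← hE', f3, Zn, Complex.real_smul]
      have f4 : ∑ i ∈ Finset.Icc 1 r, ((((i:ℝ) - α) * (B i n ω : ℝ) : ℝ) : ℂ) *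
          (E ω * Complex.exp (Complex.I*((t*(cc α r i/√(K n ω : ℝ)):ℝ) : ℂ)) - E ω) =
          E ω * ∑ i ∈ Finset.Icc 1 r, ((((i:ℝ)-α)*(B i n ω : ℝ):ℝ) : ℂ)*(Complex.exp (Complex.I*((t*(cc α r i/√(K n ω : ℝ)):ℝ) : ℂ))-1) := by
        rw [Finset.mul_sum]
        exact Finset.sum_congr rfl fun i _ => by ring
      rw [f4]
      ring
    rw [e4, norm_mul, hE, norm_expI, one_mul]
    exact this
  refine le_trans (le_of_eq ?_) e3
  rw [← e2]
  rfl

end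
end

section
section

lemma pt_bound (t z lam s y : ℝ) :
    ‖Complex.exp (Complex.I * ((t * z : ℝ) : ℂ)) *
      (1 - (s:ℂ) * (Complex.I * ((t * (lam * z) : ℝ) : ℂ)) - (y : ℂ))
      - ((1 - y : ℝ) : ℂ) * Complex.exp (Complex.I * (((1 - lam * s) * t * z : ℝ) : ℂ))‖ ≤
      (lam * s * t) ^ 2 * z ^ 2 + |y| * (|lam * s * t| * |z|) := by
  have e : Complex.exp (Complex.I * (((1 - lam * s) * t * z : ℝ) : ℂ)) =
      Complex.exp (Complex.I * ((t * z : ℝ) : ℂ)) * Complex.exp (Complex.I * ((-(lam * s * t * z) : ℝ) : ℂ)) := by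
    rw [← Complex.exp_add]; congr 1; push_cast; ring
  rw [e]
  have b1 := exp_bound1 (-(lam * s * t * z))
  have b2 := exp_bound2 (-(lam * s * t * z))
  set W := Complex.exp (Complex.I * ((-(lam * s * t * z) : ℝ) : ℂ)) with hW
  have e2 : Complex.exp (Complex.I * ((t * z : ℝ) : ℂ)) *
      (1 - (s:ℂ) * (Complex.I * ((t * (lam * z) : ℝ) : ℂ)) - (y : ℂ))
      - ((1 - y : ℝ) : ℂ) * (Complex.exp (Complex.I * ((t * z : ℝ) : ℂ)) * W) =
      - (Complex.exp (Complex.I * ((t * z : ℝ) : ℂ)) *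
        ((W - 1 - Complex.I * ((-(lam * s * t * z) : ℝ) : ℂ)) - (y : ℂ) * (W - 1))) := by
    push_cast; ring
  rw [e2, norm_neg, norm_mul, norm_expI, one_mul]
  refine (norm_sub_le _ _).trans ?_
  rw [norm_mul, Complex.norm_real, Real.norm_eq_abs]
  refine add_le_add (b2.trans (le_of_eq (by ring))) (mul_le_mul_of_nonneg_left (b1.trans (le_of_eq ?_)) (abs_nonneg _))
  rw [abs_neg, abs_mul]

variable {α θ : ℝ} {Ω : Type*} {mΩ : MeasurableSpace Ω}
    {μ : Measure Ω} {F : Filtration ℕ mΩ} {K : ℕ → Ω → ℕ} {B : ℕ → ℕ → Ω → ℕ}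

variable (hEP : IsEwensPitman α θ μ F K B)
include hEP

lemma ph_step2 (r : ℕ) (n : ℕ) (hn : 1 ≤ n) (M : ℝ) (hM : ∫ ω, Zn α r K B n ω ^ 2 ∂μ ≤ M)
    (lam σ2 A s t v : ℝ) (hl : 0 < lam) (hσ : 0 ≤ σ2) (hA : 0 ≤ A) (hs : 0 ≤ s) (ht : |t| ≤ A)
    (hv : v = 2 * lam * σ2) :
    ‖(∫ ω, Complex.exp (Complex.I * ((t * Zn α r K B n ω : ℝ) : ℂ)) *
      (1 - (s : ℂ) * (Complex.I * ((t * (lam * Zn α r K B n ω) : ℝ) : ℂ)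
        + ((t ^ 2 / 2 * v : ℝ) : ℂ))) ∂μ) -
      ((1 - t ^ 2 * lam * σ2 * s : ℝ) : ℂ) * ph α r μ K B n ((1 - lam * s) * t)‖ ≤
      s * |t| * (s * (lam ^ 2 * A * M + lam * (A ^ 2 * lam * σ2) * (1 + M))) := by
  have := hEP.prob
  have i2 := int_Z2 hEP r n hn
  have i1 := int_Zabs hEP r n hn
  have hM0 : 0 ≤ M := le_trans (integral_nonneg fun ω => sq_nonneg _) hM
  have hZ1 : ∫ ω, |Zn α r K B n ω| ∂μ ≤ 1 + M := by
    have : ∫ ω, |Zn α r K B n ω| ∂μ ≤ ∫ ω, (1 + Zn α r K B n ω ^ 2) ∂μ := by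
      refine integral_mono i1 ((integrable_const _).add i2) fun ω => ?_
      have := sq_abs (Zn α r K B n ω)
      simp only
      nlinarith [sq_nonneg (|Zn α r K B n ω| - 1), abs_nonneg (Zn α r K B n ω)]
    rw [integral_add (integrable_const _) i2] at this
    simp at this
    linarith
  set y := t ^ 2 * lam * σ2 * s with hy
  have hy0 : 0 ≤ y := by positivity
  set E : Ω → ℂ := fun ω => Complex.exp (Complex.I * ((t * Zn α r K B n ω : ℝ) : ℂ)) with hE
  have e1 : ∀ ω, E ω * (1 - (s : ℂ) * (Complex.I * ((t * (lam * Zn α r K B n ω) : ℝ) : ℂ)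
        + ((t ^ 2 / 2 * v : ℝ) : ℂ))) = E ω *
      (1 - (s:ℂ) * (Complex.I * ((t * (lam * Zn α r K B n ω) : ℝ) : ℂ)) - (y : ℂ)) := by
    intro ω
    rw [hv, hy]; push_cast; ring
  have iP : Integrable (fun ω => E ω *
      (1 - (s:ℂ) * (Complex.I * ((t * (lam * Zn α r K B n ω) : ℝ) : ℂ)) - (y : ℂ))) μ := by
    have := ((int_e hEP r n hn t).mul_const ((1:ℂ) - y)).sub
      ((int_eZ hEP r n hn t).mul_const ((s:ℂ) * (Complex.I * ((t * lam : ℝ) : ℂ))))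
    refine this.congr (Eventually.of_forall fun ω => ?_)
    simp only [hE, Pi.sub_apply]; push_cast; ring
  have iE2 := (int_e hEP r n hn ((1 - lam * s) * t)).const_mul (((1 - y : ℝ) : ℂ))
  have e2 : (∫ ω, E ω * (1 - (s : ℂ) * (Complex.I * ((t * (lam * Zn α r K B n ω) : ℝ) : ℂ)
        + ((t ^ 2 / 2 * v : ℝ) : ℂ))) ∂μ) - ((1 - y : ℝ) : ℂ) * ph α r μ K B n ((1 - lam * s) * t) =
      ∫ ω, (E ω * (1 - (s:ℂ) * (Complex.I * ((t * (lam * Zn α r K B n ω) : ℝ) : ℂ)) - (y : ℂ)) -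
        ((1 - y : ℝ) : ℂ) * Complex.exp (Complex.I * (((1 - lam * s) * t * Zn α r K B n ω : ℝ) : ℂ))) ∂μ := by
    rw [integral_sub iP iE2, integral_const_mul, ph]
    simp only [e1]
  rw [e2]
  refine (norm_integral_le_integral_norm _).trans ?_
  have e3 : ∫ ω, ‖E ω * (1 - (s:ℂ) * (Complex.I * ((t * (lam * Zn α r K B n ω) : ℝ) : ℂ)) - (y : ℂ)) -
        ((1 - y : ℝ) : ℂ) * Complex.exp (Complex.I * (((1 - lam * s) * t * Zn α r K B n ω : ℝ) : ℂ))‖ ∂μ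
      ≤ ∫ ω, ((lam * s * t) ^ 2 * Zn α r K B n ω ^ 2 + |y| * (|lam * s * t| * |Zn α r K B n ω|)) ∂μ := by
    refine integral_mono (iP.sub iE2).norm
      ((i2.const_mul _).add ((i1.const_mul _).const_mul _)) fun ω => pt_bound _ _ _ _ _
  refine e3.trans ?_
  rw [integral_add (i2.const_mul _) ((i1.const_mul _).const_mul _), integral_const_mul,
    integral_const_mul, integral_const_mul, abs_of_nonneg hy0, abs_mul, abs_of_nonneg (by positivity : 0 ≤ lam * s)]
  have htA : t ^ 2 ≤ A ^ 2 := by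
    rw [← sq_abs]; exact pow_le_pow_left₀ (abs_nonneg _) ht 2
  have hyA : y ≤ A ^ 2 * lam * σ2 * s := by rw [hy]; gcongr
  have q1 : (lam * s * t) ^ 2 ≤ lam ^ 2 * s ^ 2 * (A * |t|) := by
    rw [mul_pow, mul_pow, ← sq_abs t, sq |t|]; gcongr
  calc _ ≤ lam ^ 2 * s ^ 2 * (A * |t|) * M + (A ^ 2 * lam * σ2 * s) * (lam * s * |t| * (1 + M)) := by
        gcongr
    _ = _ := by ring

lemma ph_tendsto (hα0 : 0 < α) (hα1 : α < 1) (hθ : 0 < α + θ) (r : ℕ) (hr : 1 ≤ r) (t : ℝ) :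
    Tendsto (fun n => ph α r μ K B n t) atTop (𝓝 ((Real.exp (-((sibuya α r *
      (risingFactorial ((r : ℝ) - α) r / (Nat.factorial r : ℝ))) * t ^ 2 / 2)) : ℝ) : ℂ)) := by
  have hθ1 : -1 < θ := by linarith
  have hr' : (1:ℝ) ≤ r := by exact_mod_cast hr
  set σ2 := sibuya α r * (risingFactorial ((r : ℝ) - α) r / (Nat.factorial r : ℝ)) with hσ2
  have hσ : 0 ≤ σ2 := by
    have h1 := rf_pos (by linarith : 0 < (r:ℝ) - α) r
    have h2 := rf_pos (by linarith : 0 < 1 - α) (r - 1)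
    rw [hσ2, sibuya]
    positivity
  set lam : ℝ := (r:ℝ) - α / 2 with hlam
  have hl : 0 < lam := by rw [hlam]; linarith
  have hvar := variance_identity α r hr
  rw [← hσ2] at hvar
  set v := α * cc α r 0 ^ 2 + ∑ i ∈ Finset.Icc 1 r, ((i:ℝ) - α) * sibuya α i * cc α r i ^ 2 with hv
  have hv2 : v = 2 * lam * σ2 := by rw [hvar, hlam]; ring
  have hA := abs_nonneg t
  obtain ⟨C, hC, hstep⟩ := ph_step1 hEP hα0 hα1 hθ r hr (|t|) hA v hv
  obtain ⟨M, N, hMN⟩ := sq_bdd hEP hα0 hα1 hθ r hr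
  set G : ℝ := lam ^ 2 * |t| * M + lam * (|t| ^ 2 * lam * σ2) * (1 + M) with hG
  have hG0 : 0 ≤ G := by positivity
  have hs : Tendsto (fun n : ℕ => 1 / ((n:ℝ) + θ)) atTop (𝓝 0) := by
    have := tendsto_atTop_add_const_right atTop θ (tendsto_natCast_atTop_atTop (R := ℝ))
    simp only [one_div]
    exact this.inv_tendsto_atTop
  refine char_rec θ hθ1 lam σ2 (|t|) hl hσ hA (ph α r μ K B)
    (fun n => C * |∫ ω, Rn α r K B n ω ∂μ| + |1 / ((n:ℝ) + θ)| * G) ?_ (fun n => by positivity)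
    (max 1 N) ?_ ?_ t le_rfl
  · have := ((R_tendsto hEP hα0 hα1 hθ r hr).abs.const_mul C).add (hs.abs.mul_const G)
    simpa using this
  · intro n hn u hu
    have hn1 : 1 ≤ n := (le_max_left _ _).trans hn
    have hp : (0:ℝ) < n + θ := by
      have : (1:ℝ) ≤ n := by exact_mod_cast hn1
      linarith
    have b1 := hstep n hn1 u hu
    have hMn : ∫ ω, Zn α r K B n ω ^ 2 ∂μ ≤ M := by
      simp only [Zsq]; exact hMN n ((le_max_right _ _).trans hn)
    have hs0 : 0 ≤ 1 / ((n:ℝ) + θ) := by positivity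
    have b2 := ph_step2 hEP r n hn1 M hMn lam σ2 (|t|) (1 / ((n:ℝ) + θ)) u v hl hσ hA hs0 hu hv2
    rw [← hG] at b2
    have b3 := norm_sub_le_norm_sub_add_norm_sub (ph α r μ K B (n+1) u) _ _ |>.trans (add_le_add b1 b2)
    refine b3.trans ?_
    have hR := le_abs_self (∫ ω, Rn α r K B n ω ∂μ)
    rw [abs_of_nonneg hs0]
    generalize 1 / ((n:ℝ) + θ) = s at *
    calc _ ≤ s * (C * |u| * |∫ ω, Rn α r K B n ω ∂μ|) + s * |u| * (s * G) := by gcongr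
      _ = _ := by ring
  · intro n hn
    exact ⟨_, integral_nonneg fun ω => abs_nonneg _, ph_base hEP r n ((le_max_left _ _).trans hn)⟩

end
end


lemma weak_conv {α θ : ℝ} {Ω : Type*} {mΩ : MeasurableSpace Ω}
    {μ : Measure Ω} {F : Filtration ℕ mΩ} {K : ℕ → Ω → ℕ} {B : ℕ → ℕ → Ω → ℕ}
    (hEP : IsEwensPitman α θ μ F K B) (hα0 : 0 < α) (hα1 : α < 1) (hθ : 0 < α + θ) (r : ℕ) (hr : 1 ≤ r)
    (f : BoundedContinuousFunction ℝ ℝ) :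
    Tendsto (fun n => ∫ ω, f (Zn α r K B n ω) ∂μ) atTop
      (𝓝 (∫ x, f x ∂(gaussianReal 0 (Real.toNNReal
          (sibuya α r * (risingFactorial ((r : ℝ) - α) r / (Nat.factorial r : ℝ))))))) := by
  have := hEP.prob
  have hr' : (1:ℝ) ≤ r := by exact_mod_cast hr
  have hlim := ph_tendsto hEP hα0 hα1 hθ r hr
  set σ2 := sibuya α r * (risingFactorial ((r : ℝ) - α) r / (Nat.factorial r : ℝ)) with hσ2
  have hσ : 0 ≤ σ2 := by
    have h1 := rf_pos (by linarith : 0 < (r:ℝ) - α) r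
    have h2 := rf_pos (by linarith : 0 < 1 - α) (r - 1)
    rw [hσ2, sibuya]
    positivity
  have hm : ∀ n, Measurable (Zn α r K B n) := fun n =>
    meas_g0 hEP r n (fun x k => x / √(k:ℝ)) (fun k => by fun_prop)
  let ν : ℕ → ProbabilityMeasure ℝ := fun n =>
    ⟨μ.map (Zn α r K B n), Measure.isProbabilityMeasure_map (hm n).aemeasurable⟩
  let ν0 : ProbabilityMeasure ℝ := ⟨gaussianReal 0 (Real.toNNReal σ2), inferInstance⟩
  have hconv : Tendsto ν atTop (𝓝 ν0) := by
    rw [ProbabilityMeasure.tendsto_iff_tendsto_charFun]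
    intro t
    have e0 : charFun (ν0 : Measure ℝ) t = ((Real.exp (-(σ2 * t ^ 2 / 2)) : ℝ) : ℂ) := by
      have : (ν0 : Measure ℝ) = gaussianReal 0 (Real.toNNReal σ2) := rfl
      rw [this, charFun_gaussianReal, Real.coe_toNNReal _ hσ]
      push_cast
      congr 1
      ring
    have e1 : ∀ n, charFun (ν n : Measure ℝ) t = ph α r μ K B n t := by
      intro n
      have : (ν n : Measure ℝ) = μ.map (Zn α r K B n) := rfl
      rw [this, charFun_apply_real, integral_map (hm n).aemeasurable (by fun_prop), ph]
      refine integral_congr_ae (Eventually.of_forall fun ω => ?_)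
      simp only
      congr 1
      push_cast
      ring
    rw [e0]
    simp only [e1]
    exact hlim t
  have h2 := ProbabilityMeasure.tendsto_iff_forall_integral_tendsto.1 hconv f
  refine h2.congr fun n => ?_
  have : (ν n : Measure ℝ) = μ.map (Zn α r K B n) := rfl
  rw [this, integral_map (hm n).aemeasurable f.continuous.aestronglyMeasurable]

/-- For every `r ≥ 1`, `√(K_n) (∑_{i=1}^r b_{r,i} P_{i,n} + (-1)^r p_α(r))` converges in
distribution to a centered Gaussian with variance `p_α(r) (r-α)^(r)/r!`; in particular,
for `r = 1`, `√(K_n)(P_{1,n} - α)` converges in distribution to a centered Gaussian with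
variance `α(1-α)`. -/
theorem scalar_clt (α θ : ℝ) (hα0 : 0 < α) (hα1 : α < 1) (hθ : 0 < α + θ)
    {Ω : Type*} [mΩ : MeasurableSpace Ω] (μ : Measure Ω) (F : Filtration ℕ mΩ)
    (K : ℕ → Ω → ℕ) (B : ℕ → ℕ → Ω → ℕ) (hEP : IsEwensPitman α θ μ F K B) :
    (∀ r, 1 ≤ r → ∀ f : BoundedContinuousFunction ℝ ℝ,
      Tendsto
        (fun n => ∫ ω, f (Real.sqrt (K n ω : ℝ) *
          (∑ i ∈ Finset.Icc 1 r, bCoef α r i * ((B i n ω : ℝ) / (K n ω : ℝ)) +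
            (-1 : ℝ) ^ r * sibuya α r)) ∂μ)
        atTop
        (𝓝 (∫ x, f x ∂(gaussianReal 0 (Real.toNNReal
          (sibuya α r * (risingFactorial ((r : ℝ) - α) r / (Nat.factorial r : ℝ)))))))) ∧
    (∀ f : BoundedContinuousFunction ℝ ℝ,
      Tendsto
        (fun n => ∫ ω, f (Real.sqrt (K n ω : ℝ) *
          ((B 1 n ω : ℝ) / (K n ω : ℝ) - α)) ∂μ)
        atTop
        (𝓝 (∫ x, f x ∂(gaussianReal 0 (Real.toNNReal (α * (1 - α))))))) := by
  have h1 : ∀ r, 1 ≤ r → ∀ f : BoundedContinuousFunction ℝ ℝ,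
      Tendsto
        (fun n => ∫ ω, f (Real.sqrt (K n ω : ℝ) *
          (∑ i ∈ Finset.Icc 1 r, bCoef α r i * ((B i n ω : ℝ) / (K n ω : ℝ)) +
            (-1 : ℝ) ^ r * sibuya α r)) ∂μ)
        atTop
        (𝓝 (∫ x, f x ∂(gaussianReal 0 (Real.toNNReal
          (sibuya α r * (risingFactorial ((r : ℝ) - α) r / (Nat.factorial r : ℝ))))))) := by
    intro r hr f
    refine (weak_conv hEP hα0 hα1 hθ r hr f).congr' ?_
    filter_upwards [eventually_ge_atTop 1] with n hn
    refine integral_congr_ae ?_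
    filter_upwards [ae_basic hEP n hn] with ω ⟨hk, _⟩
    have hk : (1:ℝ) ≤ K n ω := by exact_mod_cast hk
    have hk0 : (0:ℝ) < K n ω := by linarith
    have hsq : √(K n ω : ℝ) * √(K n ω : ℝ) = K n ω := Real.mul_self_sqrt hk0.le
    have hs0 : 0 < √(K n ω : ℝ) := Real.sqrt_pos.2 hk0
    have e : √(K n ω : ℝ) * (∑ i ∈ Finset.Icc 1 r, bCoef α r i * ((B i n ω : ℝ) / (K n ω : ℝ)) +
            (-1 : ℝ) ^ r * sibuya α r) = Zn α r K B n ω := by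
      have hb := bCoef_zero α r hr
      have hb' : (-1 : ℝ) ^ r * sibuya α r = - bCoef α r 0 := by rw [hb]; ring
      rw [hb', Zn, Tn, eq_div_iff hs0.ne']
      simp only [← mul_div_assoc, ← Finset.sum_div]
      generalize ∑ i ∈ Finset.Icc 1 r, bCoef α r i * (B i n ω : ℝ) = S
      calc _ = (√(K n ω : ℝ) * √(K n ω : ℝ)) * (S / K n ω + - bCoef α r 0) := by ring
        _ = _ := by rw [hsq]; field_simp; ring
    rw [e]
  refine ⟨h1, fun f => ?_⟩
  have h2 := h1 1 le_rfl f
  have e1 : sibuya α 1 = α := by simp [sibuya, risingFactorial]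
  have e2 : bCoef α 1 1 = 1 := bCoef_self α 1
  have e3 : risingFactorial (((1:ℕ) : ℝ) - α) 1 = 1 - α := by simp [risingFactorial]
  rw [e1, e3] at h2
  simpa [e2, ← sub_eq_add_neg] using h2

end
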